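/- arXiv:2008.05106 — 12 statements merged into one kernel-verified Lean document; each statement's English description precedes it below -/
import Mathlib

section
/- Let n ≥ 2, M ≥ 1, and K ≥ 1 be integers with K ≤ M, let U be a finite set with |U| = M, and let A_1, …, A_n ⊆ U be sets with |A_i| ≥ K for every i. Then there exists a subset X ⊆ U with |X| ≤ ⌈(2M/K)·log n⌉ such that X ∩ A_i ≠ ∅ for every i = 1, …, n. -/
open Finset in
/-- If every set of the family indexed by `S` has at least `K` elements in `U`, then some element
of `U` lies in at least a fraction `K / #U` of the sets. -/
theorem exists_mem_card_filter_ge {α ι : Type*} [DecidableEq α] {U : Finset α}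
    (hU : U.Nonempty) (S : Finset ι) (A : ι → Finset α) (K : ℕ)
    (hAU : ∀ i, A i ⊆ U) (hAK : ∀ i, K ≤ (A i).card) :
    ∃ u ∈ U, K * S.card ≤ U.card * (S.filter fun i => u ∈ A i).card := by
  apply exists_le_of_sum_le hU
  have hcount : ∑ u ∈ U, (S.filter fun i => u ∈ A i).card = ∑ i ∈ S, (A i).card := by
    have h := sum_card_bipartiteAbove_eq_sum_card_bipartiteBelow
      (s := U) (t := S) (fun u i => u ∈ A i)
    simp only [bipartiteAbove, bipartiteBelow] at h
    rw [h]
    refine sum_congr rfl fun i _ => ?_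
    rw [filter_mem_eq_inter, inter_eq_right.mpr (hAU i)]
  rw [sum_const, smul_eq_mul, ← mul_sum, hcount, mul_comm K]
  gcongr
  exact card_nsmul_le_sum S _ K fun i _ => hAK i

open Finset in
/-- The greedy choice of `t` points of `U` leaves at most a fraction `(1 - K / #U) ^ t` of the
sets of the family unhit. -/
theorem exists_card_unhit_le {α ι : Type*} [DecidableEq α] [Fintype ι] {U : Finset α}
    (hU : U.Nonempty) (A : ι → Finset α) {K : ℕ} (hKU : K ≤ U.card)
    (hAU : ∀ i, A i ⊆ U) (hAK : ∀ i, K ≤ (A i).card) (t : ℕ) :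
    ∃ X ⊆ U, X.card ≤ t ∧
      ((univ.filter fun i => Disjoint X (A i)).card : ℝ) ≤
        Fintype.card ι * (1 - (K : ℝ) / U.card) ^ t := by
  have hpos : (0 : ℝ) < U.card := by exact_mod_cast hU.card_pos
  induction t with
  | zero => exact ⟨∅, empty_subset _, by simp, by simp⟩
  | succ t ih =>
    obtain ⟨X, hXU, hXt, hX⟩ := ih
    set S := univ.filter fun i => Disjoint X (A i) with hS
    obtain ⟨u, huU, hu⟩ := exists_mem_card_filter_ge hU S A K hAU hAK
    refine ⟨insert u X, insert_subset huU hXU, (card_insert_le u X).trans (by omega), ?_⟩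
    have hunhit : (univ.filter fun i => Disjoint (insert u X) (A i)) =
        S.filter fun i => ¬ u ∈ A i := by
      ext i
      simp [hS, disjoint_insert_left, and_comm]
    have hsplit := card_filter_add_card_filter_not (s := S) fun i => u ∈ A i
    rw [hunhit]
    have hsplit' : ((S.filter fun i => u ∈ A i).card : ℝ) +
        (S.filter fun i => ¬ u ∈ A i).card = S.card := by exact_mod_cast hsplit
    have hu' : (K : ℝ) / U.card * S.card ≤ (S.filter fun i => u ∈ A i).card := by
      rw [div_mul_eq_mul_div, div_le_iff₀' hpos]
      exact_mod_cast hu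
    have hfrac : (0 : ℝ) ≤ 1 - (K : ℝ) / U.card := by
      rw [sub_nonneg, div_le_one hpos]
      exact_mod_cast hKU
    calc ((S.filter fun i => ¬ u ∈ A i).card : ℝ)
        ≤ S.card * (1 - (K : ℝ) / U.card) := by linarith
      _ ≤ Fintype.card ι * (1 - (K : ℝ) / U.card) ^ t * (1 - (K : ℝ) / U.card) := by gcongr
      _ = _ := by ring

/-- A hitting-set size of `2 / p * log n` makes `n * (1 - p) ^ t` smaller than one. -/
theorem mul_one_sub_pow_lt_one {n t : ℕ} {p : ℝ} (hn : 2 ≤ n) (hp : 0 < p) (hp1 : p ≤ 1)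
    (ht : 2 / p * Real.log n ≤ t) : (n : ℝ) * (1 - p) ^ t < 1 := by
  have hn0 : (0 : ℝ) < n := by positivity
  have hlog : 0 < Real.log n := Real.log_pos (by exact_mod_cast hn)
  have hpt : 2 * Real.log n ≤ t * p := by
    rwa [div_mul_eq_mul_div, div_le_iff₀ hp] at ht
  calc (n : ℝ) * (1 - p) ^ t
      ≤ n * Real.exp (-p) ^ t := by
        gcongr
        exact Real.one_sub_le_exp_neg p
    _ = Real.exp (Real.log n - t * p) := by
        rw [← Real.exp_nat_mul, sub_eq_add_neg, Real.exp_add, Real.exp_log hn0, mul_neg]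
    _ < 1 := Real.exp_lt_one_iff.mpr (by linarith)

/-- Let n ≥ 2, M ≥ 1, K ≥ 1 be integers with K ≤ M, U a finite set with
|U| = M, and A_1, …, A_n ⊆ U with |A_i| ≥ K for every i.  Then there is X ⊆ U with
|X| ≤ ⌈(2M/K)·log n⌉ (natural logarithm) meeting every A_i. -/
theorem stmt0 {α : Type*} [DecidableEq α] (n M K : ℕ)
    (hn : 2 ≤ n) (hM : 1 ≤ M) (hK : 1 ≤ K) (hKM : K ≤ M)
    (U : Finset α) (hU : U.card = M)
    (A : Fin n → Finset α) (hAU : ∀ i, A i ⊆ U) (hAK : ∀ i, K ≤ (A i).card) :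
    ∃ X : Finset α, X ⊆ U ∧
      X.card ≤ ⌈(2 * (M : ℝ) / (K : ℝ)) * Real.log n⌉₊ ∧
      ∀ i, (X ∩ A i).Nonempty := by
  subst hU
  have hM0 : (0 : ℝ) < U.card := by exact_mod_cast hM
  have hK0 : (0 : ℝ) < K := by exact_mod_cast hK
  obtain ⟨X, hXU, hXt, hX⟩ := exists_card_unhit_le (Finset.card_pos.mp hM) A hKM hAU hAK
    ⌈(2 * (U.card : ℝ) / (K : ℝ)) * Real.log n⌉₊
  refine ⟨X, hXU, hXt, fun i => ?_⟩
  have hlt := mul_one_sub_pow_lt_one (p := (K : ℝ) / U.card) hn (by positivity)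
    ((div_le_one hM0).mpr (by exact_mod_cast hKM))
    (t := ⌈(2 * (U.card : ℝ) / (K : ℝ)) * Real.log n⌉₊) (by
      rw [div_div_eq_mul_div]
      exact Nat.le_ceil _)
  rw [Fintype.card_fin] at hX
  have hzero : (Finset.univ.filter fun i => Disjoint X (A i)).card = 0 :=
    Nat.lt_one_iff.mp (by exact_mod_cast hX.trans_lt hlt)
  rw [Finset.card_eq_zero, Finset.filter_eq_empty_iff] at hzero
  exact Finset.not_disjoint_iff_nonempty_inter.mp (hzero (Finset.mem_univ i))
end

section
/- Let G be a finite strongly connected directed weighted graph with n ≥ 2 vertices and m edges, and let D, D_1, D_2, M_1, M_2 be positive real numbers with D_1 + D_2 ≥ D, M_1 ≥ 3, M_2 ≥ 3, and M_1·M_2 ≥ 32·m·log m. Suppose that d(u,v) ≤ D for all vertices u, v. Then either there exists a vertex subset Y with |Y| ≤ M_1 such that d(v,Y) ≤ D_1 for every vertex v, or there exists a vertex subset Z with |Z| ≤ M_2 such that d(Z,v) ≤ D_2 for every vertex v. -/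
namespace Stmt1

/-- A finite directed weighted graph: an edge relation on the (finite) vertex type
together with a positive real weight on each edge. -/
structure DWGraph (V : Type*) where
  Edge : V → V → Prop
  w : V → V → ℝ
  w_pos : ∀ u v, Edge u v → 0 < w u v

variable {V : Type*}

/-- `l` is a directed walk from `u` to `v`: it starts at `u`, ends at `v`, and
consecutive vertices are joined by edges. -/
def IsWalk (G : DWGraph V) (u v : V) (l : List V) : Prop :=
  l.head? = some u ∧ l.getLast? = some v ∧ l.Chain' G.Edge

/-- The length (total weight) of a walk. -/
def walkCost (G : DWGraph V) (l : List V) : ℝ :=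
  ((l.zip l.tail).map fun p => G.w p.1 p.2).sum

/-- Every ordered pair of vertices is joined by a directed walk. -/
def StronglyConnected (G : DWGraph V) : Prop :=
  ∀ u v : V, ∃ l : List V, IsWalk G u v l

/-- Shortest-path distance: the infimum of the lengths of directed walks from `u` to `v`. -/
noncomputable def gdist (G : DWGraph V) (u v : V) : ℝ :=
  sInf {c : ℝ | ∃ l : List V, IsWalk G u v l ∧ walkCost G l = c}

theorem exists_hitting_set {ι α : Type*} (E : Finset α) (S : ι → Finset α) (s : ℝ)
    (hE : E.Nonempty) (hSE : ∀ i, S i ⊆ E) (hs : ∀ i, s ≤ (S i).card) (F : Finset ι) (k : ℕ) :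
    ∃ H : Finset α, H.card ≤ k ∧ ∃ U : Finset ι, (∀ i ∈ F, i ∉ U → ∃ a ∈ H, a ∈ S i) ∧
      (U.card : ℝ) ≤ F.card * Real.exp (-(k * (s / E.card))) := by
  classical
  induction k with
  | zero => exact ⟨∅, by simp, F, fun i hi hi' => absurd hi hi', by simp⟩
  | succ k ih =>
    obtain ⟨H, hHk, U, hU, hUc⟩ := ih
    have hEpos : (0 : ℝ) < E.card := by exact_mod_cast hE.card_pos
    have hcount : ∑ a ∈ E, ((U.filter (a ∈ S ·)).card : ℝ) = ∑ i ∈ U, ((S i).card : ℝ) := by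
      have h := Finset.sum_card_bipartiteAbove_eq_sum_card_bipartiteBelow
        (s := E) (t := U) (fun a i => a ∈ S i)
      have h2 : ∀ i, E.bipartiteBelow (fun a i => a ∈ S i) i = S i := fun i => by
        ext a
        simp only [Finset.mem_bipartiteBelow]
        exact ⟨fun h => h.2, fun h => ⟨hSE i h, h⟩⟩
      simp only [h2] at h
      exact_mod_cast h
    have hsum : ∑ _a ∈ E, (U.card * s / E.card : ℝ) ≤
        ∑ a ∈ E, ((U.filter (a ∈ S ·)).card : ℝ) := by
      rw [hcount, Finset.sum_const, nsmul_eq_mul, mul_div_cancel₀ _ hEpos.ne']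
      simpa [nsmul_eq_mul] using Finset.card_nsmul_le_sum U (fun i => ((S i).card : ℝ)) s
        (fun i _ => hs i)
    obtain ⟨a, -, ha⟩ := Finset.exists_le_of_sum_le hE hsum
    refine ⟨insert a H, (Finset.card_insert_le _ _).trans (by omega), U.filter (a ∉ S ·), ?_, ?_⟩
    · intro i hi hiU
      by_cases h : i ∈ U
      · exact ⟨a, by simp, by simpa [h] using hiU⟩
      · obtain ⟨b, hb, hb'⟩ := hU i hi h
        exact ⟨b, by simp [hb], hb'⟩
    · have hsplit : ((U.filter (a ∈ S ·)).card : ℝ) + (U.filter (a ∉ S ·)).card = U.card := by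
        exact_mod_cast Finset.card_filter_add_card_filter_not (s := U) (a ∈ S ·)
      have hexp : 1 - s / E.card ≤ Real.exp (-(s / E.card)) :=
        Real.one_sub_le_exp_neg _
      calc ((U.filter (a ∉ S ·)).card : ℝ) ≤ U.card * (1 - s / E.card) := by
            rw [mul_sub, mul_one, ← mul_div_assoc]; linarith
        _ ≤ U.card * Real.exp (-(s / E.card)) := by gcongr
        _ ≤ F.card * Real.exp (-(k * (s / E.card))) * Real.exp (-(s / E.card)) := by gcongr
        _ = F.card * Real.exp (-((k + 1 : ℕ) * (s / E.card))) := by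
            rw [mul_assoc, ← Real.exp_add]; push_cast; ring_nf

theorem walkCost_cons_cons (G : DWGraph V) (a b : V) (t : List V) :
    walkCost G (a :: b :: t) = G.w a b + walkCost G (b :: t) := by
  simp [walkCost]

theorem IsWalk.cons {G : DWGraph V} {a b v : V} {l : List V} (h : G.Edge a b)
    (hl : IsWalk G b v l) :
    IsWalk G a v (a :: l) ∧ walkCost G (a :: l) = G.w a b + walkCost G l := by
  obtain ⟨h1, h2, h3⟩ := hl
  cases l with
  | nil => simp at h1
  | cons c t =>
    obtain rfl : c = b := by simpa using h1
    exact ⟨⟨rfl, by simpa using h2, List.isChain_cons_cons.2 ⟨h, h3⟩⟩, walkCost_cons_cons G _ _ _⟩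

theorem isWalk_singleton (G : DWGraph V) (v : V) : IsWalk G v v [v] :=
  ⟨rfl, rfl, List.isChain_singleton _⟩

theorem walkCost_nonneg {G : DWGraph V} {l : List V} (hl : l.IsChain G.Edge) :
    0 ≤ walkCost G l := by
  induction l with
  | nil => simp [walkCost]
  | cons a l ih =>
    cases l with
    | nil => simp [walkCost]
    | cons b t =>
      rw [List.isChain_cons_cons] at hl
      rw [walkCost_cons_cons]
      exact add_nonneg (G.w_pos _ _ hl.1).le (ih hl.2)

theorem gdist_le_walkCost {G : DWGraph V} {u v : V} {l : List V} (hl : IsWalk G u v l) :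
    gdist G u v ≤ walkCost G l :=
  csInf_le ⟨0, by rintro _ ⟨l, hl, rfl⟩; exact walkCost_nonneg hl.2.2⟩ ⟨l, hl, rfl⟩

theorem gdist_self_nonpos (G : DWGraph V) (v : V) : gdist G v v ≤ 0 := by
  simpa [walkCost] using gdist_le_walkCost (isWalk_singleton G v)

theorem IsWalk.exists_crossing {G : DWGraph V} {B : Set V} {l : List V} {u v : V}
    (hl : IsWalk G v u l) (hv : v ∈ B) (hu : u ∉ B) :
    ∃ x ∈ B, ∃ y ∉ B, G.Edge x y ∧ gdist G v y + gdist G y u ≤ walkCost G l := by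
  suffices h : ∃ x ∈ B, ∃ y ∉ B, G.Edge x y ∧ ∃ l₁ l₂, IsWalk G v y l₁ ∧ IsWalk G y u l₂ ∧
      walkCost G l₁ + walkCost G l₂ = walkCost G l by
    obtain ⟨x, hx, y, hy, he, l₁, l₂, h₁, h₂, h⟩ := h
    exact ⟨x, hx, y, hy, he, h ▸ add_le_add (gdist_le_walkCost h₁) (gdist_le_walkCost h₂)⟩
  induction l generalizing v with
  | nil => simp [IsWalk] at hl
  | cons a l ih =>
    obtain ⟨h1, h2, h3⟩ := hl
    obtain rfl : a = v := by simpa using h1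
    cases l with
    | nil =>
      obtain rfl : a = u := by simpa using h2
      exact absurd hv hu
    | cons b t =>
      obtain ⟨he, h3⟩ := List.isChain_cons_cons.1 h3
      have hbt : IsWalk G b u (b :: t) := ⟨rfl, by simpa using h2, h3⟩
      by_cases hb : b ∈ B
      · obtain ⟨x, hx, y, hy, hxy, l₁, l₂, hl₁, hl₂, h⟩ := ih hbt hb
        obtain ⟨hw, hc⟩ := hl₁.cons he
        exact ⟨x, hx, y, hy, hxy, a :: l₁, l₂, hw, hl₂, by
          rw [hc, walkCost_cons_cons, ← h, add_assoc]⟩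
      · obtain ⟨hw, hc⟩ := (isWalk_singleton G b).cons he
        exact ⟨a, hv, b, hb, he, [a, b], b :: t, hw, hbt, by
          rw [hc, walkCost_cons_cons]; simp [walkCost]⟩

theorem StronglyConnected.exists_edge [Nontrivial V] {G : DWGraph V} (hG : StronglyConnected G)
    (v : V) : ∃ w, G.Edge v w := by
  obtain ⟨u, hu⟩ := exists_ne v
  obtain ⟨l, hl⟩ := hG v u
  obtain ⟨x, rfl, y, -, h, -⟩ := hl.exists_crossing (B := {v}) rfl hu
  exact ⟨y, h⟩

/-- A vertex outside a set `B` is close to the head of some edge leaving `B`, provided that the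
vertices outside `B` are far from `v ∈ B`. -/
theorem StronglyConnected.exists_edge_gdist_le [Finite V] {G : DWGraph V}
    (hG : StronglyConnected G) {B : Set V} {u v : V} {D D1 D2 : ℝ} (hv : v ∈ B) (hu : u ∉ B)
    (hB : ∀ y ∉ B, D1 < gdist G v y) (hD : gdist G v u ≤ D) (hsum : D ≤ D1 + D2) :
    ∃ x ∈ B, ∃ y, G.Edge x y ∧ gdist G y u ≤ D2 := by
  by_contra! hcon
  let T : Set V := {y | y ∉ B ∧ ∃ x ∈ B, G.Edge x y}
  obtain ⟨l, hl⟩ := hG v u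
  obtain ⟨x₀, hx₀, y₀, hy₀, he₀, -⟩ := hl.exists_crossing hv hu
  obtain ⟨z, ⟨hzB, x, hx, hxz⟩, hz⟩ := Set.exists_min_image T
    (fun y => gdist G v y + gdist G y u) T.toFinite ⟨y₀, hy₀, x₀, hx₀, he₀⟩
  have hle : gdist G v z + gdist G z u ≤ gdist G v u := by
    refine le_csInf ⟨_, l, hl, rfl⟩ ?_
    rintro _ ⟨l', hl', rfl⟩
    obtain ⟨x', hx', y', hy', he', hc⟩ := hl'.exists_crossing hv hu
    exact (hz y' ⟨hy', x', hx', he'⟩).trans hc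
  linarith [hB z hzB, hcon x hx z hxz]

/-- In a finite strongly connected directed weighted graph with `n ≥ 2`
vertices, `m` edges, `D, D₁, D₂, M₁, M₂ > 0`, `D₁ + D₂ ≥ D`, `M₁, M₂ ≥ 3`,
`M₁·M₂ ≥ 32·m·log m`, and all distances at most `D`: either there is `Y` with
`|Y| ≤ M₁` and `d(v,Y) ≤ D₁` for all `v`, or there is `Z` with `|Z| ≤ M₂` and
`d(Z,v) ≤ D₂` for all `v`. -/
theorem stmt1 [Fintype V] (G : DWGraph V) (n m : ℕ)
    (hn : Fintype.card V = n) (hn2 : 2 ≤ n)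
    (hm : {p : V × V | G.Edge p.1 p.2}.ncard = m)
    (hconn : StronglyConnected G)
    (D D1 D2 M1 M2 : ℝ)
    (hD : 0 < D) (hD1 : 0 < D1) (hD2 : 0 < D2)
    (hsum : D ≤ D1 + D2) (hM1 : 3 ≤ M1) (hM2 : 3 ≤ M2)
    (hMM : 32 * (m : ℝ) * Real.log m ≤ M1 * M2)
    (hdiam : ∀ u v : V, gdist G u v ≤ D) :
    (∃ Y : Finset V, (Y.card : ℝ) ≤ M1 ∧ ∀ v : V, ∃ y ∈ Y, gdist G v y ≤ D1) ∨
    (∃ Z : Finset V, (Z.card : ℝ) ≤ M2 ∧ ∀ v : V, ∃ z ∈ Z, gdist G z v ≤ D2) := by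
  classical
  have : Nontrivial V := Fintype.one_lt_card_iff_nontrivial.1 (by omega)
  choose f hf using hconn.exists_edge
  let E : Finset (V × V) := Finset.univ.filter fun p => G.Edge p.1 p.2
  have hEm : E.card = m := by
    rw [← hm, ← Set.ncard_coe_finset]
    simp [E]
  have hnm : n ≤ m := by
    rw [← hn, ← hEm, ← Finset.card_univ]
    exact Finset.card_le_card_of_injOn (fun v => (v, f v)) (fun v _ => by simp [E, hf])
      (fun a _ b _ h => (Prod.ext_iff.1 h).1)
  let S : V → Finset (V × V) := fun v => E.filter fun p => gdist G v p.1 ≤ D1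
  by_cases hS : ∃ v, ((S v).card : ℝ) ≤ M2 / 2
  · obtain ⟨v, hv⟩ := hS
    right
    refine ⟨(S v).image Prod.fst ∪ (S v).image Prod.snd, ?_, fun u => ?_⟩
    · have h : ((S v).image Prod.fst ∪ (S v).image Prod.snd).card ≤ (S v).card + (S v).card :=
        (Finset.card_union_le _ _).trans
          (add_le_add Finset.card_image_le Finset.card_image_le)
      have h' : (((S v).image Prod.fst ∪ (S v).image Prod.snd).card : ℝ) ≤
          (S v).card + (S v).card := by exact_mod_cast h
      linarith
    · by_cases hu : gdist G v u ≤ D1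
      · refine ⟨u, Finset.mem_union_left _ (Finset.mem_image.2 ⟨(u, f u), ?_, rfl⟩),
          (gdist_self_nonpos G u).trans hD2.le⟩
        simp [S, E, hu, hf]
      · obtain ⟨x, hx, y, hxy, hy⟩ := hconn.exists_edge_gdist_le (B := {x | gdist G v x ≤ D1})
          ((gdist_self_nonpos G v).trans hD1.le) hu (fun y hy => not_le.1 hy) (hdiam v u) hsum
        refine ⟨y, Finset.mem_union_right _ (Finset.mem_image.2 ⟨(x, y), ?_, rfl⟩), hy⟩
        simpa [S, E, hxy] using hx
  · push Not at hS
    left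
    have hm0 : (0 : ℝ) < m := by exact_mod_cast (by omega : 0 < m)
    have hn0 : (0 : ℝ) < n := by exact_mod_cast (by omega : 0 < n)
    have hM20 : 0 < M2 := by linarith
    have hlog : Real.log n ≤ Real.log m := Real.log_le_log hn0 (by exact_mod_cast hnm)
    have hlogn : 0 ≤ Real.log n := Real.log_natCast_nonneg n
    have hE : E.Nonempty := Finset.card_pos.1 (by omega)
    let r : ℝ := 2 * m * Real.log n / M2
    have hr0 : 0 ≤ r := by positivity
    have hr : r ≤ M1 / 16 := by
      rw [div_le_iff₀ hM20]
      nlinarith [mul_le_mul_of_nonneg_left hlog hm0.le]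
    obtain ⟨H, hHk, U, hU, hUc⟩ := exists_hitting_set E S (M2 / 2) hE
      (fun v => Finset.filter_subset _ _) (fun v => (hS v).le) Finset.univ (⌊r⌋₊ + 1)
    have hU0 : U = ∅ := by
      rw [← Finset.card_eq_zero, ← Nat.lt_one_iff]
      suffices h : (U.card : ℝ) < 1 by exact_mod_cast h
      refine hUc.trans_lt ?_
      rw [Finset.card_univ, hn, hEm]
      have hlt : Real.log n < ((⌊r⌋₊ + 1 : ℕ) : ℝ) * (M2 / 2 / m) := by
        have h1 : r < ((⌊r⌋₊ + 1 : ℕ) : ℝ) := by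
          push_cast
          exact Nat.lt_floor_add_one r
        calc Real.log n = r * (M2 / 2 / m) := by
              simp only [r]
              field_simp
          _ < _ := by gcongr
      calc (n : ℝ) * Real.exp (-(((⌊r⌋₊ + 1 : ℕ) : ℝ) * (M2 / 2 / m)))
          < n * Real.exp (-Real.log n) := by gcongr
        _ = 1 := by rw [Real.exp_neg, Real.exp_log hn0, mul_inv_cancel₀ hn0.ne']
    refine ⟨H.image Prod.fst, ?_, fun v => ?_⟩
    · have h1 : ((H.image Prod.fst).card : ℝ) ≤ (⌊r⌋₊ + 1 : ℕ) := by
        exact_mod_cast Finset.card_image_le.trans hHk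
      have h2 := Nat.floor_le hr0
      push_cast at h1
      linarith
    · obtain ⟨p, hp, hpS⟩ := hU v (Finset.mem_univ v) (by simp [hU0])
      exact ⟨p.1, Finset.mem_image_of_mem _ hp, (Finset.mem_filter.1 hpS).2⟩

end Stmt1
end

section
/- For every integer k ≥ 3 there exists a constant C = C(k) such that the following holds for every integer d ≥ 1 and every nonempty finite set A ⊆ {0,1}^d with |A| = ñ. The k-OV Diameter graph G(A,k,d) has at most C·ñ^{k−1}·d^{2k−1} vertices and directed edges in total. Moreover: (a) if A has no Single-Set k-OV solution, then every ordered pair of vertices of G(A,k,d) is joined by a directed walk with exactly k edges; and (b) if there exist a_1, …, a_k ∈ A with (a_1,…,a_{k−1}) ≠ (a_2,…,a_k) such that for every coordinate x ∈ {1,…,d} some i ∈ {1,…,k} satisfies a_i[x] = 0, then there are two vertices of G(A,k,d) that are not joined by any directed walk with at most 2k−2 edges. -/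
namespace OVDiam

/-- Boolean vectors of dimension `d`; `a x = true` encodes `a[x] = 1`. -/
abbrev Vec (d : ℕ) := Fin d → Bool

/-- The vertex type of the k-OV Diameter graph.  A vertex of `L₀` is
`Sum.inl ā` with `ā : Fin (k−1) → Vec d` (a tuple `(a₁,…,a_{k−1})`, 0-indexed);
a vertex of `Lᵢ` for `1 ≤ i ≤ k−1` is `Sum.inr (i, ā, x̄)` with
`ā : Fin (k−2) → Vec d` and `x̄ : Fin (k−1) → Fin d` (index tuples, 0-indexed:
`x_j` of the paper is `x̄ (j−1)`). -/
abbrev OVVert (k d : ℕ) :=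
  (Fin (k - 1) → Vec d) ⊕ (ℕ × (Fin (k - 2) → Vec d) × (Fin (k - 1) → Fin d))

/-- Property `(i, L₁)`: `a[x₁] = ⋯ = a[x_{k−i}] = 1`. -/
def PropL1 (k d : ℕ) (i : ℕ) (a : Vec d) (x : Fin (k - 1) → Fin d) : Prop :=
  ∀ j : Fin (k - 1), (j : ℕ) + 1 ≤ k - i → a (x j) = true

/-- Property `(i, L_{k−1})`: `a[x_{k+1−i}] = ⋯ = a[x_{k−1}] = 1`. -/
def PropLk (k d : ℕ) (i : ℕ) (a : Vec d) (x : Fin (k - 1) → Fin d) : Prop :=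
  ∀ j : Fin (k - 1), k + 1 - i ≤ (j : ℕ) + 1 → a (x j) = true

/-- Membership condition for `L₁`: `(a_j, x̄)` has property `(j, L₁)` for `1 ≤ j ≤ k−2`. -/
def InL1 (k d : ℕ) (a : Fin (k - 2) → Vec d) (x : Fin (k - 1) → Fin d) : Prop :=
  ∀ j : Fin (k - 2), PropL1 k d ((j : ℕ) + 1) (a j) x

/-- Membership condition for `L_{k−1}`: `(a_{j−2}, x̄)` has property `(j, L_{k−1})`
for `3 ≤ j ≤ k`. -/
def InLk (k d : ℕ) (a : Fin (k - 2) → Vec d) (x : Fin (k - 1) → Fin d) : Prop :=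
  ∀ j : Fin (k - 2), PropLk k d ((j : ℕ) + 3) (a j) x

/-- The vertex set of `G(A,k,d)`. -/
def IsVertex (k d : ℕ) (A : Finset (Vec d)) : OVVert k d → Prop
  | Sum.inl a => ∀ j, a j ∈ A
  | Sum.inr (i, a, x) =>
      1 ≤ i ∧ i ≤ k - 1 ∧ (∀ j, a j ∈ A) ∧
      (i = 1 → InL1 k d a x) ∧ (i = k - 1 → InLk k d a x)

/-- The structural directed-edge conditions (i)–(v) of `G(A,k,d)`. -/
def EdgeCore (k d : ℕ) (hk : 3 ≤ k) : OVVert k d → OVVert k d → Prop := fun u v =>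
  -- (i) from (a₁,…,a_{k−1}) ∈ L₀ to (a₁,…,a_{k−2}, x̄) ∈ L₁ with a_{k−1}[x₁] = 1
  (∃ (a : Fin (k - 1) → Vec d) (b : Fin (k - 2) → Vec d) (x : Fin (k - 1) → Fin d),
      u = Sum.inl a ∧ v = Sum.inr (1, b, x) ∧
      (∀ j : Fin (k - 2), b j = a (Fin.castLE (by omega) j)) ∧
      a ⟨k - 2, by omega⟩ (x ⟨0, by omega⟩) = true) ∨
  -- (ii) from (a₃,…,a_k, x̄) ∈ L_{k−1} to (a₂,…,a_k) ∈ L₀ with a₂[x_{k−1}] = 1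
  (∃ (a : Fin (k - 2) → Vec d) (x : Fin (k - 1) → Fin d) (b : Fin (k - 1) → Vec d),
      u = Sum.inr (k - 1, a, x) ∧ v = Sum.inl b ∧
      (∀ j : Fin (k - 2), a j = b ⟨(j : ℕ) + 1, by have := j.isLt; omega⟩) ∧
      b ⟨0, by omega⟩ (x ⟨k - 2, by omega⟩) = true) ∨
  -- (iii) from (ā, x̄) ∈ Lᵢ to (b̄, x̄) ∈ L_{i+1} with a_j = b_j for j ≠ k−1−i
  (∃ (i : ℕ) (a b : Fin (k - 2) → Vec d) (x : Fin (k - 1) → Fin d),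
      1 ≤ i ∧ i ≤ k - 2 ∧ u = Sum.inr (i, a, x) ∧ v = Sum.inr (i + 1, b, x) ∧
      ∀ j : Fin (k - 2), (j : ℕ) ≠ k - 2 - i → a j = b j) ∨
  -- (iv) from (ā, x̄) ∈ Lᵢ to (ā, x̄′) ∈ L₁
  (∃ (i : ℕ) (a : Fin (k - 2) → Vec d) (x x' : Fin (k - 1) → Fin d),
      1 ≤ i ∧ i ≤ k - 1 ∧ u = Sum.inr (i, a, x) ∧ v = Sum.inr (1, a, x')) ∨
  -- (v) from (ā, x̄) ∈ L_{k−1} to (ā, x̄′) ∈ Lᵢ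
  (∃ (i : ℕ) (a : Fin (k - 2) → Vec d) (x x' : Fin (k - 1) → Fin d),
      1 ≤ i ∧ i ≤ k - 1 ∧ u = Sum.inr (k - 1, a, x) ∧ v = Sum.inr (i, a, x'))

/-- The directed edges of `G(A,k,d)`: both endpoints are vertices and one of the
edge conditions (i)–(v) holds. -/
def Edge (k d : ℕ) (hk : 3 ≤ k) (A : Finset (Vec d)) (u v : OVVert k d) : Prop :=
  IsVertex k d A u ∧ IsVertex k d A v ∧ EdgeCore k d hk u v

/-- There is a directed walk with exactly `ℓ` edges from `u` to `v` in `G(A,k,d)`. -/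
def HasWalk (k d : ℕ) (hk : 3 ≤ k) (A : Finset (Vec d)) (u v : OVVert k d) (ℓ : ℕ) : Prop :=
  ∃ w : ℕ → OVVert k d, w 0 = u ∧ w ℓ = v ∧ ∀ t, t < ℓ → Edge k d hk A (w t) (w (t + 1))

/-- `A` has no Single-Set k-OV solution: every `k`-tuple of vectors from `A` has a
common coordinate equal to 1. -/
def NoSingleSetSolution (k d : ℕ) (A : Finset (Vec d)) : Prop :=
  ∀ a : Fin k → Vec d, (∀ i, a i ∈ A) → ∃ x : Fin d, ∀ i, a i x = true

end OVDiam

namespace OVDiam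

/-! ### Counting vertices and edges -/

theorem mem_piFinset_const {m d : ℕ} {A : Finset (Vec d)} {a : Fin m → Vec d}
    (ha : ∀ j, a j ∈ A) : a ∈ Fintype.piFinset (fun _ : Fin m => A) :=
  Fintype.mem_piFinset.2 ha

theorem ncard_vertices_le (k d : ℕ) (A : Finset (Vec d)) :
    {v : OVVert k d | IsVertex k d A v}.ncard ≤
      A.card ^ (k - 1) + k * (A.card ^ (k - 2) * d ^ (k - 1)) := by
  classical
  let P := fun m => Fintype.piFinset (fun _ : Fin m => A)
  let F : Finset (OVVert k d) :=
    (P (k - 1)).image Sum.inl ∪ (Finset.range k ×ˢ P (k - 2) ×ˢ Finset.univ).image Sum.inr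
  have hsub : {v : OVVert k d | IsVertex k d A v} ⊆ (F : Set (OVVert k d)) := by
    rintro (a | ⟨i, a, x⟩) hv
    · exact Finset.mem_union_left _ (Finset.mem_image_of_mem _ (mem_piFinset_const hv))
    · obtain ⟨h1, h2, h3, -⟩ := hv
      refine Finset.mem_union_right _ (Finset.mem_image_of_mem _ ?_)
      simp only [Finset.mem_product, Finset.mem_range, Finset.mem_univ, and_true]
      exact ⟨by omega, mem_piFinset_const h3⟩
  refine (Set.ncard_le_ncard hsub F.finite_toSet).trans ?_
  rw [Set.ncard_coe_finset]
  refine (Finset.card_union_le _ _).trans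
    (add_le_add (Finset.card_image_le.trans ?_) (Finset.card_image_le.trans ?_)) <;>
    simp [P]

theorem ncard_edges_le (k d : ℕ) (hk : 3 ≤ k) (A : Finset (Vec d)) :
    {p : OVVert k d × OVVert k d | Edge k d hk A p.1 p.2}.ncard ≤
      2 * (A.card ^ (k - 1) * d ^ (k - 1)) +
        k * (A.card ^ (k - 2) * (A.card * d ^ (k - 1))) +
        2 * (k * (A.card ^ (k - 2) * (d ^ (k - 1) * d ^ (k - 1)))) := by
  classical
  let P := fun m => Fintype.piFinset (fun _ : Fin m => A)
  let X : Finset (Fin (k - 1) → Fin d) := Finset.univ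
  let F₁ : Finset (OVVert k d × OVVert k d) := (P (k - 1) ×ˢ X).image fun p =>
    (Sum.inl p.1, Sum.inr (1, fun j => p.1 (Fin.castLE (by omega) j), p.2))
  let F₂ : Finset (OVVert k d × OVVert k d) := (P (k - 1) ×ˢ X).image fun p =>
    (Sum.inr (k - 1, fun j => p.1 ⟨(j : ℕ) + 1, by have := j.isLt; omega⟩, p.2), Sum.inl p.1)
  let F₃ : Finset (OVVert k d × OVVert k d) :=
    (Finset.range k ×ˢ P (k - 2) ×ˢ A ×ˢ X).image fun p =>
      (Sum.inr (p.1, p.2.1, p.2.2.2),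
        Sum.inr (p.1 + 1, fun j => if (j : ℕ) = k - 2 - p.1 then p.2.2.1 else p.2.1 j, p.2.2.2))
  let F₄ : Finset (OVVert k d × OVVert k d) :=
    (Finset.range k ×ˢ P (k - 2) ×ˢ X ×ˢ X).image fun p =>
      (Sum.inr (p.1, p.2.1, p.2.2.1), Sum.inr (1, p.2.1, p.2.2.2))
  let F₅ : Finset (OVVert k d × OVVert k d) :=
    (Finset.range k ×ˢ P (k - 2) ×ˢ X ×ˢ X).image fun p =>
      (Sum.inr (k - 1, p.2.1, p.2.2.1), Sum.inr (p.1, p.2.1, p.2.2.2))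
  let F := (F₁ ∪ F₂) ∪ F₃ ∪ (F₄ ∪ F₅)
  have hsub : {p : OVVert k d × OVVert k d | Edge k d hk A p.1 p.2} ⊆
      (F : Set (OVVert k d × OVVert k d)) := by
    rintro ⟨u, v⟩ ⟨hu, hv, h⟩
    simp only [F, Finset.coe_union, Set.mem_union, Finset.mem_coe]
    rcases h with ⟨a, b, x, rfl, rfl, hab, -⟩ | ⟨a, x, b, rfl, rfl, hab, -⟩ |
      ⟨i, a, b, x, h1, h2, rfl, rfl, hab⟩ | ⟨i, a, x, x', h1, h2, rfl, rfl⟩ |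
      ⟨i, a, x, x', h1, h2, rfl, rfl⟩
    · refine Or.inl (Or.inl (Or.inl (Finset.mem_image.2 ⟨(a, x), ?_, ?_⟩)))
      · exact Finset.mem_product.2 ⟨mem_piFinset_const hu, Finset.mem_univ _⟩
      · rw [funext hab]
    · refine Or.inl (Or.inl (Or.inr (Finset.mem_image.2 ⟨(b, x), ?_, ?_⟩)))
      · exact Finset.mem_product.2 ⟨mem_piFinset_const hv, Finset.mem_univ _⟩
      · rw [funext hab]
    · refine Or.inl (Or.inr (Finset.mem_image.2
        ⟨(i, a, b ⟨k - 2 - i, by omega⟩, x), ?_, ?_⟩))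
      · simp only [X, Finset.mem_product, Finset.mem_range, Finset.mem_univ, and_true]
        exact ⟨by omega, mem_piFinset_const hu.2.2.1, hv.2.2.1 _⟩
      · have : (fun j : Fin (k - 2) =>
            if (j : ℕ) = k - 2 - i then b ⟨k - 2 - i, by omega⟩ else a j) = b := by
          funext j
          split_ifs with hj
          · congr 1
            exact Fin.ext hj.symm
          · exact hab j hj
        simp only [this]
    · refine Or.inr (Or.inl (Finset.mem_image.2 ⟨(i, a, x, x'), ?_, rfl⟩))
      simp only [X, Finset.mem_product, Finset.mem_range, Finset.mem_univ, and_true]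
      exact ⟨by omega, mem_piFinset_const hu.2.2.1⟩
    · refine Or.inr (Or.inr (Finset.mem_image.2 ⟨(i, a, x, x'), ?_, rfl⟩))
      simp only [X, Finset.mem_product, Finset.mem_range, Finset.mem_univ, and_true]
      exact ⟨by omega, mem_piFinset_const hu.2.2.1⟩
  have c₁ : F₁.card ≤ A.card ^ (k - 1) * d ^ (k - 1) :=
    Finset.card_image_le.trans (by simp [P, X])
  have c₂ : F₂.card ≤ A.card ^ (k - 1) * d ^ (k - 1) :=
    Finset.card_image_le.trans (by simp [P, X])
  have c₃ : F₃.card ≤ k * (A.card ^ (k - 2) * (A.card * d ^ (k - 1))) :=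
    Finset.card_image_le.trans (by simp [P, X])
  have c₄ : F₄.card ≤ k * (A.card ^ (k - 2) * (d ^ (k - 1) * d ^ (k - 1))) :=
    Finset.card_image_le.trans (by simp [P, X])
  have c₅ : F₅.card ≤ k * (A.card ^ (k - 2) * (d ^ (k - 1) * d ^ (k - 1))) :=
    Finset.card_image_le.trans (by simp [P, X])
  refine (Set.ncard_le_ncard hsub F.finite_toSet).trans ?_
  rw [Set.ncard_coe_finset]
  have u₁ := Finset.card_union_le (F₁ ∪ F₂ ∪ F₃) (F₄ ∪ F₅)
  have u₂ := Finset.card_union_le (F₁ ∪ F₂) F₃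
  have u₃ := Finset.card_union_le F₁ F₂
  have u₄ := Finset.card_union_le F₄ F₅
  have : F.card = (F₁ ∪ F₂ ∪ F₃ ∪ (F₄ ∪ F₅)).card := rfl
  omega

theorem card_bound (k n d : ℕ) (hk : 3 ≤ k) (hn : 1 ≤ n) (hd : 1 ≤ d) :
    n ^ (k - 1) + k * (n ^ (k - 2) * d ^ (k - 1)) +
      (2 * (n ^ (k - 1) * d ^ (k - 1)) + k * (n ^ (k - 2) * (n * d ^ (k - 1))) +
        2 * (k * (n ^ (k - 2) * (d ^ (k - 1) * d ^ (k - 1))))) ≤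
      (3 + 4 * k) * n ^ (k - 1) * d ^ (2 * k - 1) := by
  have e₁ : n ^ (k - 2) * n = n ^ (k - 1) := by rw [← pow_succ]; congr 1; omega
  have e₂ : d ^ (k - 1) * d ^ (k - 1) ≤ d ^ (2 * k - 1) := by
    rw [← pow_add]; exact Nat.pow_le_pow_right hd (by omega)
  have hN : n ^ (k - 2) ≤ n ^ (k - 1) := Nat.pow_le_pow_right hn (by omega)
  have hD : d ^ (k - 1) ≤ d ^ (2 * k - 1) := Nat.pow_le_pow_right hd (by omega)
  have hD' : 1 ≤ d ^ (2 * k - 1) := Nat.one_le_pow _ _ hd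
  rw [← mul_assoc (n ^ (k - 2)) n, e₁]
  have b₀ := Nat.mul_le_mul_left (n ^ (k - 1)) hD'
  have b₁ := Nat.mul_le_mul_left k (Nat.mul_le_mul hN hD)
  have b₂ := Nat.mul_le_mul_left (n ^ (k - 1)) hD
  have b₃ := Nat.mul_le_mul_left k b₂
  have b₄ := Nat.mul_le_mul_left k (Nat.mul_le_mul hN e₂)
  linarith

/-! ### Short walks when there is no solution -/

/-- Every vertex has edges to all copies in `L₁` of some tuple of vectors in `A`. -/
theorem exists_edge_to_first_layer {k d : ℕ} (hk : 3 ≤ k) {A : Finset (Vec d)}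
    {u : OVVert k d} (hu : IsVertex k d A u) :
    ∃ a : Fin (k - 1) → Vec d, (∀ j, a j ∈ A) ∧
      ∀ (c : Fin (k - 2) → Vec d) (x : Fin (k - 1) → Fin d),
        (∀ j : Fin (k - 2), c j = a (Fin.castLE (by omega) j)) →
        InL1 k d c x → a ⟨k - 2, by omega⟩ (x ⟨0, by omega⟩) = true →
        Edge k d hk A u (Sum.inr (1, c, x)) := by
  rcases u with a | ⟨i, c, y⟩
  · refine ⟨a, hu, fun c x hc hx h => ⟨hu, ?_, Or.inl ⟨a, c, x, rfl, rfl, hc, h⟩⟩⟩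
    exact ⟨le_rfl, by omega, fun j => hc j ▸ hu _, fun _ => hx, fun h => by omega⟩
  · obtain ⟨h1, h2, h3, -⟩ := id hu
    refine ⟨fun j => if h : (j : ℕ) < k - 2 then c ⟨j, h⟩ else c ⟨0, by omega⟩,
      fun j => ?_, fun c' x hc hx h => ?_⟩
    · dsimp only
      split_ifs <;> exact h3 _
    · obtain rfl : c' = c := funext fun j => by simp [hc j]
      refine ⟨hu, ⟨le_rfl, by omega, h3, fun _ => hx, fun h => by omega⟩, ?_⟩
      exact Or.inr (Or.inr (Or.inr (Or.inl ⟨i, c', y, x, h1, h2, rfl, rfl⟩)))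

/-- Every vertex has edges from all copies in `L_{k-1}` of some tuple of vectors in `A`. -/
theorem exists_edge_from_last_layer {k d : ℕ} (hk : 3 ≤ k) {A : Finset (Vec d)}
    {v : OVVert k d} (hv : IsVertex k d A v) :
    ∃ b : Fin (k - 1) → Vec d, (∀ j, b j ∈ A) ∧
      ∀ (c : Fin (k - 2) → Vec d) (x : Fin (k - 1) → Fin d),
        (∀ j : Fin (k - 2), c j = b ⟨(j : ℕ) + 1, by have := j.isLt; omega⟩) →
        InLk k d c x → b ⟨0, by omega⟩ (x ⟨k - 2, by omega⟩) = true →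
        Edge k d hk A (Sum.inr (k - 1, c, x)) v := by
  rcases v with b | ⟨i, c, y⟩
  · refine ⟨b, hv, fun c x hc hx h => ⟨?_, hv, Or.inr (Or.inl ⟨c, x, b, rfl, rfl, hc, h⟩)⟩⟩
    exact ⟨by omega, le_rfl, fun j => hc j ▸ hv _, fun h => by omega, fun _ => hx⟩
  · obtain ⟨h1, h2, h3, -⟩ := id hv
    refine ⟨fun j => if h : (j : ℕ) - 1 < k - 2 then c ⟨j - 1, h⟩ else c ⟨0, by omega⟩,
      fun j => ?_, fun c' x hc hx h => ?_⟩
    · dsimp only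
      split_ifs <;> exact h3 _
    · obtain rfl : c' = c := funext fun j => by simp [hc j]
      refine ⟨⟨by omega, le_rfl, h3, fun h => by omega, fun _ => hx⟩, hv, ?_⟩
      exact Or.inr (Or.inr (Or.inr (Or.inr ⟨i, c', x, y, h1, h2, rfl, rfl⟩)))

/-- Coordinates at which a prefix of `a` and a suffix of `b` are all `1`. -/
theorem NoSingleSetSolution.exists_coords {k d : ℕ} {A : Finset (Vec d)}
    (hA : NoSingleSetSolution k d A) {a b : Fin (k - 1) → Vec d}
    (ha : ∀ j, a j ∈ A) (hb : ∀ j, b j ∈ A) :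
    ∃ x : Fin (k - 1) → Fin d,
      (∀ m j : Fin (k - 1), (j : ℕ) + m + 2 ≤ k → a j (x m) = true) ∧
      (∀ m j : Fin (k - 1), k < (j : ℕ) + m + 3 → b j (x m) = true) := by
  have key : ∀ m : Fin (k - 1), ∃ y : Fin d,
      (∀ j : Fin (k - 1), (j : ℕ) + m + 2 ≤ k → a j y = true) ∧
      (∀ j : Fin (k - 1), k < (j : ℕ) + m + 3 → b j y = true) := by
    intro m
    have hm := m.isLt
    obtain ⟨y, hy⟩ := hA
      (fun i => if h : (i : ℕ) + m + 2 ≤ k then a ⟨i, by omega⟩ else b ⟨i - 1, by omega⟩)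
      (fun i => by split_ifs; exacts [ha _, hb _])
    refine ⟨y, fun j hj => ?_, fun j hj => ?_⟩
    · simpa [hj] using hy ⟨j, by omega⟩
    · have := hy ⟨j + 1, by omega⟩
      rw [dif_neg (by simp only; omega)] at this
      exact this
  choose x hx using key
  exact ⟨x, fun m => (hx m).1, fun m => (hx m).2⟩

theorem hasWalk_of_noSingleSetSolution {k d : ℕ} (hk : 3 ≤ k) {A : Finset (Vec d)}
    (hA : NoSingleSetSolution k d A) {u v : OVVert k d}
    (hu : IsVertex k d A u) (hv : IsVertex k d A v) : HasWalk k d hk A u v k := by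
  obtain ⟨a, ha, hau⟩ := exists_edge_to_first_layer hk hu
  obtain ⟨b, hb, hbv⟩ := exists_edge_from_last_layer hk hv
  obtain ⟨x, hxa, hxb⟩ := hA.exists_coords ha hb
  let c : ℕ → Fin (k - 2) → Vec d := fun t j =>
    if (j : ℕ) + t + 1 < k then a (Fin.castLE (by omega) j)
    else b ⟨(j : ℕ) + 1, by have := j.isLt; omega⟩
  have hc1 : ∀ j : Fin (k - 2), c 1 j = a (Fin.castLE (by omega) j) := fun j =>
    if_pos (by have := j.isLt; omega)
  have hck : ∀ j : Fin (k - 2), c (k - 1) j = b ⟨(j : ℕ) + 1, by have := j.isLt; omega⟩ :=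
    fun j => if_neg (by omega)
  have hcA : ∀ t j, c t j ∈ A := fun t j => by
    dsimp only [c]
    split_ifs
    exacts [ha _, hb _]
  have hL1 : InL1 k d (c 1) x := fun j m hm => by
    rw [hc1]
    exact hxa _ _ (by simp only [Fin.val_castLE]; have := j.isLt; omega)
  have hLk : InLk k d (c (k - 1)) x := fun j m hm => by
    rw [hck]
    exact hxb _ _ (by simp only; omega)
  have hvert : ∀ t, 1 ≤ t → t ≤ k - 1 → IsVertex k d A (Sum.inr (t, c t, x)) := fun t h1 h2 =>
    ⟨h1, h2, hcA t, fun h => h ▸ hL1, fun h => h ▸ hLk⟩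
  refine ⟨fun t => if t = 0 then u else if t = k then v else Sum.inr (t, c t, x),
    by simp, by simp; omega, fun t ht => ?_⟩
  rcases Nat.eq_zero_or_pos t with rfl | h0
  · simp only [if_true, zero_add, one_ne_zero, if_false, if_neg (show ¬ 1 = k by omega)]
    exact hau _ _ hc1 hL1 (hxa _ _ (by simp only; omega))
  · simp only [if_neg (show ¬ t = 0 by omega), if_neg (show ¬ t = k by omega),
      if_neg (show ¬ t + 1 = 0 by omega)]
    split_ifs with h
    · obtain rfl : t = k - 1 := by omega
      exact hbv _ _ hck hLk (hxb _ _ (by simp only; omega))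
    · refine ⟨hvert t h0 (by omega), hvert (t + 1) (by omega) (by omega), ?_⟩
      refine Or.inr (Or.inr (Or.inl ⟨t, c t, c (t + 1), x, h0, by omega, rfl, rfl,
        fun j hj => ?_⟩))
      have hiff : (j : ℕ) + t + 1 < k ↔ (j : ℕ) + (t + 1) + 1 < k := by
        have := j.isLt
        omega
      simp only [c, hiff]

/-! ### No short walk between two vertices of `L₀` given by an orthogonal tuple -/

theorem Edge.of_inl {k d : ℕ} {hk : 3 ≤ k} {A : Finset (Vec d)} {a : Fin (k - 1) → Vec d}
    {v : OVVert k d} (h : Edge k d hk A (Sum.inl a) v) :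
    ∃ c x, v = Sum.inr (1, c, x) ∧
      (∀ j : Fin (k - 2), c j = a (Fin.castLE (by omega) j)) ∧
      a ⟨k - 2, by omega⟩ (x ⟨0, by omega⟩) = true := by
  rcases h.2.2 with ⟨a, b, x, hu, rfl, hab, h⟩ | ⟨a, x, b, hu, -, -, -⟩ |
    ⟨i, a, b, x, h1, h2, hu, -, -⟩ | ⟨i, a, x, x', h1, h2, hu, -⟩ |
    ⟨i, a, x, x', h1, h2, hu, -⟩
  · cases hu
    exact ⟨b, x, rfl, hab, h⟩
  all_goals cases hu

theorem Edge.of_inr {k d : ℕ} {hk : 3 ≤ k} {A : Finset (Vec d)} {i : ℕ}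
    {c : Fin (k - 2) → Vec d} {x : Fin (k - 1) → Fin d} {v : OVVert k d}
    (h : Edge k d hk A (Sum.inr (i, c, x)) v) :
    (i = k - 1 ∧ ∃ b, v = Sum.inl b ∧
      (∀ j : Fin (k - 2), c j = b ⟨(j : ℕ) + 1, by have := j.isLt; omega⟩) ∧
      b ⟨0, by omega⟩ (x ⟨k - 2, by omega⟩) = true) ∨
    (i ≤ k - 2 ∧ ∃ c', v = Sum.inr (i + 1, c', x) ∧
      ∀ j : Fin (k - 2), (j : ℕ) ≠ k - 2 - i → c j = c' j) ∨
    (∃ x', v = Sum.inr (1, c, x')) ∨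
    (i = k - 1 ∧ ∃ i' x', v = Sum.inr (i', c, x')) := by
  rcases h.2.2 with ⟨a, b, x, hu, -, -, -⟩ | ⟨a, x, b, hu, rfl, hab, h⟩ |
    ⟨i, a, b, x, h1, h2, hu, rfl, hab⟩ | ⟨i, a, x, x', h1, h2, hu, rfl⟩ |
    ⟨i, a, x, x', h1, h2, hu, rfl⟩
  · cases hu
  · cases hu
    exact Or.inl ⟨rfl, b, rfl, hab, h⟩
  · cases hu
    exact Or.inr (Or.inl ⟨h2, b, rfl, hab⟩)
  · cases hu
    exact Or.inr (Or.inr (Or.inl ⟨x', rfl⟩))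
  · cases hu
    exact Or.inr (Or.inr (Or.inr ⟨rfl, i, x', rfl⟩))

section Walk

variable {k d : ℕ} {hk : 3 ≤ k} {A : Finset (Vec d)} {w : ℕ → OVVert k d} {ℓ : ℕ}

/-- Early in a walk starting in `L₀` the layer is low and few vectors have changed. -/
theorem walk_forward (hw : ∀ t, t < ℓ → Edge k d hk A (w t) (w (t + 1)))
    {a : Fin (k - 1) → Vec d} (h0 : w 0 = Sum.inl a) {t : ℕ} (h1 : 1 ≤ t) (hℓ : t ≤ ℓ)
    (htk : t ≤ k - 1) :
    ∃ i c x, w t = Sum.inr (i, c, x) ∧ 1 ≤ i ∧ i ≤ t ∧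
      ∀ j : Fin (k - 2), (j : ℕ) + 1 + t < k → c j = a (Fin.castLE (by omega) j) := by
  induction t, h1 using Nat.le_induction with
  | base =>
    obtain ⟨c, x, h, hc, -⟩ := (h0 ▸ hw 0 hℓ).of_inl
    exact ⟨1, c, x, h, le_rfl, le_rfl, fun j _ => hc j⟩
  | succ t h1 ih =>
    obtain ⟨i, c, x, h, hi1, hit, hc⟩ := ih (by omega) (by omega)
    rcases (h ▸ hw t (by omega)).of_inr with ⟨hi, -⟩ | ⟨hi, c', h', hcc⟩ | ⟨x', h'⟩ | ⟨hi, -⟩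
    · omega
    · exact ⟨i + 1, c', x, h', by omega, by omega, fun j hj =>
        (hcc j (by omega)).symm.trans (hc j (by omega))⟩
    · exact ⟨1, c, x', h', le_rfl, by omega, fun j hj => hc j (by omega)⟩
    · omega

/-- Late in a walk ending in `L₀` the layer is high and few vectors are still to change. -/
theorem walk_backward (hw : ∀ t, t < ℓ → Edge k d hk A (w t) (w (t + 1)))
    {b : Fin (k - 1) → Vec d} (hend : w ℓ = Sum.inl b) {s : ℕ} (h1 : 1 ≤ s) (hℓ : s ≤ ℓ)
    (hsk : s ≤ k - 1) :
    ∃ i c x, w (ℓ - s) = Sum.inr (i, c, x) ∧ k - s ≤ i ∧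
      ∀ j : Fin (k - 2), s ≤ (j : ℕ) + 1 →
        c j = b ⟨(j : ℕ) + 1, by have := j.isLt; omega⟩ := by
  induction s, h1 using Nat.le_induction with
  | base =>
    have he := hw (ℓ - 1) (by omega)
    rw [Nat.sub_add_cancel hℓ, hend] at he
    rcases hwt : w (ℓ - 1) with a | ⟨i, c, x⟩ <;> rw [hwt] at he
    · obtain ⟨_, _, h, -⟩ := he.of_inl
      cases h
    · rcases he.of_inr with ⟨hi, b', h', hc, -⟩ | ⟨-, c', h', -⟩ | ⟨x', h'⟩ | ⟨-, _, _, h'⟩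
      · cases h'
        exact ⟨i, c, x, rfl, hi.ge, fun j _ => hc j⟩
      all_goals cases h'
  | succ s h1 ih =>
    obtain ⟨i, c, x, h, hi, hc⟩ := ih (by omega) (by omega)
    have he := hw (ℓ - (s + 1)) (by omega)
    rw [show ℓ - (s + 1) + 1 = ℓ - s by omega, h] at he
    rcases hwt : w (ℓ - (s + 1)) with a | ⟨i', c', x'⟩ <;> rw [hwt] at he
    · obtain ⟨_, _, h', -⟩ := he.of_inl
      cases h'
      omega
    · rcases he.of_inr with ⟨-, b', h', -⟩ | ⟨hi', c₁, h', hcc⟩ | ⟨x₁, h'⟩ | ⟨hi', i₁, x₁, h'⟩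
      · cases h'
      · cases h'
        exact ⟨_, _, _, rfl, by omega, fun j hj =>
          (hcc j (by omega)).trans (hc j (by omega))⟩
      · cases h'
        omega
      · cases h'
        exact ⟨_, _, _, rfl, by omega, fun j hj => hc j (by omega)⟩

/-- From its last visit to `L₁` on, a walk ending in `L₀` climbs through all the layers
without changing its coordinates. -/
theorem walk_climb (hw : ∀ t, t < ℓ → Edge k d hk A (w t) (w (t + 1)))
    {b : Fin (k - 1) → Vec d} (hend : w ℓ = Sum.inl b) {T : ℕ} (hT : T < ℓ)
    {c : Fin (k - 2) → Vec d} {x : Fin (k - 1) → Fin d} (hwT : w T = Sum.inr (1, c, x))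
    (hlast : ∀ t, T < t → t < ℓ → ∀ c x, w t ≠ Sum.inr (1, c, x)) {n : ℕ} (hn : n ≤ k - 2) :
    T + n < ℓ ∧ ∃ c', w (T + n) = Sum.inr (n + 1, c', x) := by
  induction n with
  | zero => exact ⟨hT, c, hwT⟩
  | succ n ih =>
    obtain ⟨hlt, c', h⟩ := ih (by omega)
    have he := hw _ hlt
    rw [h] at he
    have hne : ∀ y, w (T + n + 1) = Sum.inr y → T + n + 1 < ℓ := fun y hy => by
      rcases Nat.lt_or_ge (T + n + 1) ℓ with h' | h'
      · exact h'
      · obtain rfl : ℓ = T + n + 1 := by omega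
        rw [hend] at hy
        cases hy
    rcases he.of_inr with ⟨hi, -⟩ | ⟨-, c₁, h', -⟩ | ⟨x₁, h'⟩ | ⟨hi, -⟩
    · omega
    · exact ⟨hne _ h', c₁, h'⟩
    · exact absurd h' (hlast _ (by omega) (hne _ h') _ _)
    · omega

/-- A landing in `L₁` early in a walk from `L₀` makes a prefix of the starting tuple `1` at
one of the coordinates. -/
theorem walk_head_ones (hw : ∀ t, t < ℓ → Edge k d hk A (w t) (w (t + 1)))
    {a : Fin (k - 1) → Vec d} (h0 : w 0 = Sum.inl a) {T : ℕ} (h1 : 1 ≤ T) (hT : T < ℓ)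
    (hTk : T ≤ k - 1) {c : Fin (k - 2) → Vec d} {x : Fin (k - 1) → Fin d}
    (hwT : w T = Sum.inr (1, c, x)) (j : Fin (k - 1)) (hj : (j : ℕ) + 1 + T ≤ k) :
    a j (x ⟨T - 1, by omega⟩) = true := by
  have hj' := j.isLt
  have hL : InL1 k d c x := by
    have hv := (hw T hT).1
    rw [hwT] at hv
    exact hv.2.2.2.1 rfl
  obtain ⟨t, rfl⟩ : ∃ t, T = t + 1 := ⟨T - 1, by omega⟩
  have he := hw t (by omega)
  rw [hwT] at he
  rcases Nat.eq_zero_or_pos t with rfl | ht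
  · rw [h0] at he
    obtain ⟨_, _, h, hc, hx⟩ := he.of_inl
    cases h
    rcases Nat.lt_or_ge j (k - 2) with hlt | hge
    · have := hL ⟨j, hlt⟩ ⟨0, by omega⟩ (by simp only; omega)
      rw [hc] at this
      exact this
    · have hjk : j = ⟨k - 2, by omega⟩ := Fin.ext (by simp only; omega)
      rw [hjk]
      exact hx
  · obtain ⟨i, c₁, x₁, h, hi1, -, hc⟩ := walk_forward hw h0 ht (by omega) (by omega)
    rw [h] at he
    obtain rfl : c = c₁ := by
      rcases he.of_inr with ⟨-, b', h', -⟩ | ⟨-, c₂, h', -⟩ | ⟨x₂, h'⟩ | ⟨-, i₂, x₂, h'⟩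
      · cases h'
      · cases h'
        omega
      · cases h'
        rfl
      · cases h'
        rfl
    have := hL ⟨j, by omega⟩ ⟨t, by omega⟩ (by simp only; omega)
    rw [hc _ (by simp only; omega)] at this
    exact this

/-- A visit to `L_{k-1}` late in a walk to `L₀` makes a suffix of the final tuple `1` at the
corresponding coordinates. -/
theorem walk_tail_ones (hw : ∀ t, t < ℓ → Edge k d hk A (w t) (w (t + 1)))
    {b : Fin (k - 1) → Vec d} (hend : w ℓ = Sum.inl b) {s : ℕ} (h1 : 1 ≤ s) (hℓ : s ≤ ℓ)
    {c : Fin (k - 2) → Vec d} {x : Fin (k - 1) → Fin d}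
    (hws : w (ℓ - s) = Sum.inr (k - 1, c, x)) (m j : Fin (k - 1))
    (hm : (m : ℕ) + s + 1 ≤ k) (hj : k ≤ (j : ℕ) + m + 2) :
    b j (x m) = true := by
  have hj' := j.isLt
  have hm' := m.isLt
  have he := hw (ℓ - s) (by omega)
  rw [hws] at he
  have hL : InLk k d c x := he.1.2.2.2.2 rfl
  have fin : ∀ hpos : 1 ≤ (j : ℕ),
      (∀ j' : Fin (k - 2), (j' : ℕ) + 1 = j → c j' = b j) → b j (x m) = true := by
    intro hpos h
    have := hL ⟨j - 1, by omega⟩ m (by simp only; omega)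
    rwa [h _ (by simp only; omega)] at this
  obtain ⟨s, rfl⟩ : ∃ s', s = s' + 1 := ⟨s - 1, by omega⟩
  rw [show ℓ - (s + 1) + 1 = ℓ - s by omega] at he
  rcases Nat.eq_zero_or_pos s with rfl | hs
  · rw [Nat.sub_zero, hend] at he
    rcases he.of_inr with ⟨-, b', h', hc, hx⟩ | ⟨-, _, h', -⟩ | ⟨_, h'⟩ | ⟨-, _, _, h'⟩
    · cases h'
      rcases Nat.eq_zero_or_pos (j : ℕ) with hj0 | hpos
      · have hj : j = ⟨0, by omega⟩ := Fin.ext hj0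
        have hm : m = ⟨k - 2, by omega⟩ := Fin.ext (by simp only; omega)
        rw [hj, hm]
        exact hx
      · exact fin hpos fun j' h => (hc j').trans (congrArg b (Fin.ext h))
    all_goals cases h'
  · obtain ⟨i, c₁, x₁, h, hi, hc⟩ := walk_backward hw hend hs (by omega) (by omega)
    rw [h] at he
    obtain rfl : c = c₁ := by
      rcases he.of_inr with ⟨-, b', h', -⟩ | ⟨hle, -⟩ | ⟨x₂, h'⟩ | ⟨-, i₂, x₂, h'⟩
      · cases h'
      · omega
      · cases h'
        rfl
      · cases h'
        rfl
    exact fin (by omega) fun j' h => (hc j' (by omega)).trans (congrArg b (Fin.ext h))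

/-- A walk of length at most `2k-2` between distinct vertices of `L₀` yields a coordinate at
which a prefix of the first and the complementary suffix of the second tuple are all `1`. -/
theorem exists_coord_of_walk (hw : ∀ t, t < ℓ → Edge k d hk A (w t) (w (t + 1)))
    {a b : Fin (k - 1) → Vec d} (h0 : w 0 = Sum.inl a) (hend : w ℓ = Sum.inl b) (hab : a ≠ b)
    (hℓ : ℓ ≤ 2 * k - 2) :
    ∃ (T : ℕ) (y : Fin d), 1 ≤ T ∧ T ≤ k - 1 ∧
      (∀ j : Fin (k - 1), (j : ℕ) + 1 + T ≤ k → a j y = true) ∧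
      (∀ j : Fin (k - 1), k ≤ (j : ℕ) + T + 1 → b j y = true) := by
  classical
  have hpos : 0 < ℓ := by
    rcases Nat.eq_zero_or_pos ℓ with rfl | h
    · exact absurd (Sum.inl_injective (h0.symm.trans hend)) hab
    · exact h
  obtain ⟨c₁, x₁, hw1, -⟩ := (h0 ▸ hw 0 hpos).of_inl
  have h1ℓ : 1 < ℓ := by
    by_contra h
    obtain rfl : ℓ = 1 := by omega
    rw [zero_add, hend] at hw1
    cases hw1
  let p : ℕ → Prop := fun t => ∃ c x, w t = Sum.inr (1, c, x)
  have hp1 : p 1 := ⟨c₁, x₁, hw1⟩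
  obtain ⟨T, hT⟩ : ∃ T, Nat.findGreatest p (ℓ - 1) = T := ⟨_, rfl⟩
  have hT1 : 1 ≤ T := hT ▸ Nat.le_findGreatest (by omega) hp1
  have hTℓ : T ≤ ℓ - 1 := hT ▸ Nat.findGreatest_le _
  obtain ⟨c, x, hwT⟩ : p T := hT ▸ Nat.findGreatest_spec (by omega) hp1
  have hlast : ∀ t, T < t → t < ℓ → ∀ c x, w t ≠ Sum.inr (1, c, x) := fun t h h' c x hx =>
    Nat.findGreatest_is_greatest (hT ▸ h) (by omega) ⟨c, x, hx⟩
  obtain ⟨hlt, c', hc'⟩ := walk_climb hw hend (by omega) hwT hlast (le_refl (k - 2))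
  refine ⟨T, x ⟨T - 1, by omega⟩, hT1, by omega, fun j hj =>
    walk_head_ones hw h0 hT1 (by omega) (by omega) hwT j hj, fun j hj => ?_⟩
  refine walk_tail_ones hw hend (s := ℓ - (T + (k - 2))) (c := c') (by omega) (by omega) ?_ _ j
    (by simp only; omega) (by simp only; omega)
  rw [show ℓ - (ℓ - (T + (k - 2))) = T + (k - 2) by omega, hc',
    show k - 2 + 1 = k - 1 by omega]

end Walk

theorem not_hasWalk_of_orthogonal {k d : ℕ} (hk : 3 ≤ k) {A : Finset (Vec d)}
    {a : Fin k → Vec d} {b c : Fin (k - 1) → Vec d}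
    (hb : ∀ (i : Fin k) (j : Fin (k - 1)), (i : ℕ) = j → b j = a i)
    (hc : ∀ (i : Fin k) (j : Fin (k - 1)), (i : ℕ) = j + 1 → c j = a i) (hbc : b ≠ c)
    (horth : ∀ x : Fin d, ∃ i : Fin k, a i x = false) {ℓ : ℕ} (hℓ : ℓ ≤ 2 * k - 2) :
    ¬ HasWalk k d hk A (Sum.inl b) (Sum.inl c) ℓ := by
  rintro ⟨w, h0, hend, hw⟩
  obtain ⟨T, y, hT1, hTk, hpre, hsuf⟩ := exists_coord_of_walk hw h0 hend hbc hℓ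
  obtain ⟨i, hi⟩ := horth y
  have hi' := i.isLt
  have htrue : a i y = true := by
    rcases Nat.lt_or_ge k ((i : ℕ) + 1 + T) with h | h
    · rw [← hc i ⟨i - 1, by omega⟩ (by simp only; omega)]
      exact hsuf _ (by simp only; omega)
    · rw [← hb i ⟨i, by omega⟩ rfl]
      exact hpre _ h
  rw [htrue] at hi
  cases hi

end OVDiam

open OVDiam in
/-- For every `k ≥ 3` there is `C = C(k)` such that for every `d ≥ 1` and
every nonempty `A ⊆ {0,1}^d` with `|A| = ñ`, the graph `G(A,k,d)` has at most
`C·ñ^{k−1}·d^{2k−1}` vertices and directed edges in total; moreover (a) if `A` has no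
Single-Set k-OV solution then every ordered pair of vertices is joined by a directed
walk with exactly `k` edges, and (b) if there are `a₁,…,a_k ∈ A` with
`(a₁,…,a_{k−1}) ≠ (a₂,…,a_k)` that are orthogonal, then some two vertices are not
joined by any directed walk with at most `2k−2` edges. -/
theorem stmt2 (k : ℕ) (hk : 3 ≤ k) :
    ∃ C : ℕ, ∀ d : ℕ, 1 ≤ d → ∀ A : Finset (Vec d), A.Nonempty →
      ({v : OVVert k d | IsVertex k d A v}.ncard +
          {p : OVVert k d × OVVert k d | Edge k d hk A p.1 p.2}.ncard
        ≤ C * A.card ^ (k - 1) * d ^ (2 * k - 1)) ∧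
      (NoSingleSetSolution k d A →
        ∀ u v : OVVert k d, IsVertex k d A u → IsVertex k d A v →
          HasWalk k d hk A u v k) ∧
      (∀ a : Fin k → Vec d, (∀ i, a i ∈ A) →
        (fun j : Fin (k - 1) => a (Fin.castLE (Nat.sub_le k 1) j)) ≠
          (fun j : Fin (k - 1) => a ⟨(j : ℕ) + 1, by have := j.isLt; omega⟩) →
        (∀ x : Fin d, ∃ i : Fin k, a i x = false) →
        ∃ u v : OVVert k d, IsVertex k d A u ∧ IsVertex k d A v ∧
          ∀ ℓ ≤ 2 * k - 2, ¬ HasWalk k d hk A u v ℓ) := by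
  refine ⟨3 + 4 * k, fun d hd A hA => ⟨?_, ?_, ?_⟩⟩
  · exact (add_le_add (ncard_vertices_le k d A) (ncard_edges_le k d hk A)).trans
      (card_bound k A.card d hk hA.card_pos hd)
  · exact fun h u v hu hv => hasWalk_of_noSingleSetSolution hk h hu hv
  · exact fun a ha hne horth => ⟨Sum.inl fun j => a (Fin.castLE (Nat.sub_le k 1) j),
      Sum.inl fun j => a ⟨(j : ℕ) + 1, by have := j.isLt; omega⟩, fun _ => ha _, fun _ => ha _,
      fun ℓ hℓ => not_hasWalk_of_orthogonal hk (fun i j h => congrArg a (Fin.ext h.symm))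
        (fun i j h => congrArg a (Fin.ext h.symm)) hne horth hℓ⟩
end

section
/- Suppose A has no Single-Set k-OV solution. Then for any two vertices α, α′ ∈ L_0 of the k-OV Diameter graph G(A,k,d) there is a directed walk with exactly k edges from α to α′. -/
namespace OVDiam

/-- The tuple in layer `t` of the direct walk: the last `t - 1` entries of `a` have already been
replaced by the corresponding entries of `b`. -/
def hybrid (k d : ℕ) (a b : Fin (k - 1) → Vec d) (t : ℕ) (j : Fin (k - 2)) : Vec d :=
  if k - 1 ≤ (j : ℕ) + t then b ⟨(j : ℕ) + 1, by have := j.isLt; omega⟩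
  else a ⟨j, by have := j.isLt; omega⟩

/-- The direct walk from `a` to `b` through the layers, with a fixed index tuple `x`. -/
def directWalk (k d : ℕ) (a b : Fin (k - 1) → Vec d) (x : Fin (k - 1) → Fin d) (t : ℕ) :
    OVVert k d :=
  if t = 0 then Sum.inl a else if t = k then Sum.inl b else Sum.inr (t, hybrid k d a b t, x)

/-- Without a solution, one index tuple serves all constraints of both endpoints. -/
theorem exists_common_index {k d : ℕ} {A : Finset (Vec d)} (hnosol : NoSingleSetSolution k d A)
    {a b : Fin (k - 1) → Vec d} (ha : ∀ j, a j ∈ A) (hb : ∀ j, b j ∈ A) :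
    ∃ x : Fin (k - 1) → Fin d,
      (∀ j m : Fin (k - 1), (j : ℕ) + m ≤ k - 2 → a j (x m) = true) ∧
      (∀ j m : Fin (k - 1), k - 2 ≤ (j : ℕ) + m → b j (x m) = true) := by
  have h : ∀ m : Fin (k - 1), ∃ y : Fin d,
      (∀ j : Fin (k - 1), (j : ℕ) + m ≤ k - 2 → a j y = true) ∧
      (∀ j : Fin (k - 1), k - 2 ≤ (j : ℕ) + m → b j y = true) := by
    intro m
    have hm := m.isLt
    obtain ⟨y, hy⟩ := hnosol
      (fun i => if h : (i : ℕ) + m ≤ k - 2 then a ⟨i, by omega⟩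
        else b ⟨(i : ℕ) - 1, by have := i.isLt; omega⟩)
      (fun i => by split_ifs; exacts [ha _, hb _])
    refine ⟨y, fun j hj => ?_, fun j hj => ?_⟩
    · simpa [hj] using hy ⟨j, by omega⟩
    · have hn : ¬ ((j : ℕ) + 1 + m ≤ k - 2) := by omega
      simpa [hn] using hy ⟨(j : ℕ) + 1, by omega⟩
  choose x hx using h
  exact ⟨x, fun j m => (hx m).1 j, fun j m => (hx m).2 j⟩

theorem hybrid_one {k d : ℕ} (a b : Fin (k - 1) → Vec d) (j : Fin (k - 2)) :
    hybrid k d a b 1 j = a ⟨j, by have := j.isLt; omega⟩ :=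
  if_neg (by have := j.isLt; omega)

theorem hybrid_last {k d : ℕ} (a b : Fin (k - 1) → Vec d) (j : Fin (k - 2)) :
    hybrid k d a b (k - 1) j = b ⟨(j : ℕ) + 1, by have := j.isLt; omega⟩ :=
  if_pos (by omega)

theorem hybrid_succ {k d : ℕ} (a b : Fin (k - 1) → Vec d) {t : ℕ} {j : Fin (k - 2)}
    (hj : (j : ℕ) ≠ k - 2 - t) :
    hybrid k d a b t j = hybrid k d a b (t + 1) j := by
  have := j.isLt
  unfold hybrid
  split_ifs <;> first | rfl | omega

theorem isVertex_directWalk {k d : ℕ} {A : Finset (Vec d)}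
    {a b : Fin (k - 1) → Vec d} (ha : ∀ j, a j ∈ A) (hb : ∀ j, b j ∈ A)
    {x : Fin (k - 1) → Fin d}
    (hax : ∀ j m : Fin (k - 1), (j : ℕ) + m ≤ k - 2 → a j (x m) = true)
    (hbx : ∀ j m : Fin (k - 1), k - 2 ≤ (j : ℕ) + m → b j (x m) = true)
    {t : ℕ} (ht : t ≤ k) : IsVertex k d A (directWalk k d a b x t) := by
  unfold directWalk
  split_ifs with h0 hk
  · exact ha
  · exact hb
  · refine ⟨by omega, by omega, fun j => ?_, ?_, ?_⟩
    · unfold hybrid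
      split_ifs
      exacts [hb _, ha _]
    · rintro rfl j m hm
      rw [hybrid_one]
      exact hax _ _ (by dsimp only; omega)
    · rintro rfl j m hm
      rw [hybrid_last]
      exact hbx _ _ (by dsimp only; omega)

theorem edgeCore_directWalk {k d : ℕ} (hk : 3 ≤ k)
    {a b : Fin (k - 1) → Vec d} {x : Fin (k - 1) → Fin d}
    (hax : ∀ j m : Fin (k - 1), (j : ℕ) + m ≤ k - 2 → a j (x m) = true)
    (hbx : ∀ j m : Fin (k - 1), k - 2 ≤ (j : ℕ) + m → b j (x m) = true)
    {t : ℕ} (ht : t < k) :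
    EdgeCore k d hk (directWalk k d a b x t) (directWalk k d a b x (t + 1)) := by
  rcases Nat.eq_zero_or_pos t with rfl | h0
  · refine Or.inl ⟨a, hybrid k d a b 1, x, if_pos rfl, ?_, hybrid_one a b, hax _ _ (by simp)⟩
    simp [directWalk, show 1 ≠ k by omega]
  · rcases Nat.lt_or_ge (t + 1) k with h1 | h1
    · refine Or.inr (Or.inr (Or.inl ⟨t, hybrid k d a b t, hybrid k d a b (t + 1), x, h0,
        by omega, ?_, ?_, fun j hj => hybrid_succ a b hj⟩))
      · simp [directWalk, h0.ne', ht.ne]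
      · simp [directWalk, h1.ne]
    · obtain rfl : t = k - 1 := by omega
      refine Or.inr (Or.inl ⟨hybrid k d a b (k - 1), x, b, ?_, ?_, hybrid_last a b,
        hbx _ _ (by simp)⟩)
      · simp [directWalk, h0.ne', ht.ne]
      · simp [directWalk, show k - 1 + 1 = k by omega, show k ≠ 0 by omega]

end OVDiam

open OVDiam in
/-- If `A` has no Single-Set k-OV solution, then any two vertices of `L₀`
of `G(A,k,d)` are joined by a directed walk with exactly `k` edges. -/
theorem stmt3 (k d : ℕ) (hk : 3 ≤ k) (hd : 1 ≤ d) (A : Finset (Vec d))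
    (hnosol : NoSingleSetSolution k d A)
    (a b : Fin (k - 1) → Vec d) (ha : ∀ j, a j ∈ A) (hb : ∀ j, b j ∈ A) :
    HasWalk k d hk A (Sum.inl a) (Sum.inl b) k := by
  obtain ⟨x, hax, hbx⟩ := exists_common_index hnosol ha hb
  refine ⟨directWalk k d a b x, if_pos rfl, ?_, fun t ht =>
    ⟨isVertex_directWalk ha hb hax hbx ht.le, isVertex_directWalk ha hb hax hbx ht,
      edgeCore_directWalk hk hax hbx ht⟩⟩
  simp [directWalk, show k ≠ 0 by omega]
end

section
/- Suppose A is nonempty. Then for every vertex v of the k-OV Diameter graph G(A,k,d) there exist vertices u, w ∈ L_0 such that every out-neighbor of u is an out-neighbor of v (i.e., N^out(u) ⊆ N^out(v)) and every in-neighbor of w is an in-neighbor of v (i.e., N^in(w) ⊆ N^in(v)). -/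
open OVDiam in
/-- If `A` is nonempty, then for every vertex `v` of `G(A,k,d)` there are
vertices `u, w ∈ L₀` with `N^out(u) ⊆ N^out(v)` and `N^in(w) ⊆ N^in(v)`. -/
theorem stmt4 (k d : ℕ) (hk : 3 ≤ k) (hd : 1 ≤ d) (A : Finset (Vec d)) (hA : A.Nonempty)
    (v : OVVert k d) (hv : IsVertex k d A v) :
    ∃ u w : OVVert k d,
      (∃ a : Fin (k - 1) → Vec d, u = Sum.inl a) ∧ IsVertex k d A u ∧
      (∃ b : Fin (k - 1) → Vec d, w = Sum.inl b) ∧ IsVertex k d A w ∧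
      (∀ z : OVVert k d, Edge k d hk A u z → Edge k d hk A v z) ∧
      (∀ z : OVVert k d, Edge k d hk A z w → Edge k d hk A z v) := by
  rcases v with a | ⟨i, a, x⟩
  · exact ⟨Sum.inl a, Sum.inl a, ⟨a, rfl⟩, hv, ⟨a, rfl⟩, hv, fun _ h => h, fun _ h => h⟩
  obtain ⟨c, hc⟩ := hA
  obtain ⟨hi, hi', ha, -⟩ := id hv
  refine ⟨Sum.inl fun j => if h : (j : ℕ) < k - 2 then a ⟨j, h⟩ else c,
    Sum.inl fun j => if h : 1 ≤ (j : ℕ) then a ⟨(j : ℕ) - 1, by omega⟩ else c,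
    ⟨_, rfl⟩, ?_, ⟨_, rfl⟩, ?_, ?_, ?_⟩
  · intro j
    dsimp only
    split_ifs
    exacts [ha _, hc]
  · intro j
    dsimp only
    split_ifs
    exacts [ha _, hc]
  · rintro z ⟨-, hz, ⟨a', b, x', hu, rfl, hb, -⟩ | ⟨_, _, _, hu, -⟩ |
      ⟨_, _, _, _, -, -, hu, -⟩ | ⟨_, _, _, _, -, -, hu, -⟩ | ⟨_, _, _, _, -, -, hu, -⟩⟩
    · cases hu
      obtain rfl : b = a := by
        funext j
        simp [hb j]
      exact ⟨hv, hz, .inr (.inr (.inr (.inl ⟨i, b, x, x', hi, hi', rfl, rfl⟩)))⟩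
    all_goals cases hu
  · rintro z ⟨hz, -, ⟨_, _, _, -, hw, -⟩ | ⟨a', x', b, rfl, hw, hb, -⟩ |
      ⟨_, _, _, _, -, -, -, hw, -⟩ | ⟨_, _, _, _, -, -, -, hw⟩ | ⟨_, _, _, _, -, -, -, hw⟩⟩
    · cases hw
    · cases hw
      obtain rfl : a' = a := by
        funext j
        simp [hb j]
      exact ⟨hz, hv, .inr (.inr (.inr (.inr ⟨i, a', x', x, hi, hi', rfl, rfl⟩)))⟩
    all_goals cases hw
end

section
/- Suppose A is nonempty and has no Single-Set k-OV solution. Then for every ordered pair of vertices v, v′ of the k-OV Diameter graph G(A,k,d) there is a directed walk with exactly k edges from v to v′; in particular, G(A,k,d) has diameter at most k. -/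
namespace OVDiam

/-- Two `(k-1)`-tuples from `A` admit a common index tuple realizing every prefix
condition of the first and every suffix condition of the second. -/
lemma NoSingleSetSolution.exists_index {k d : ℕ} {A : Finset (Vec d)}
    (h : NoSingleSetSolution k d A) (hk : 3 ≤ k) {a b : Fin (k - 1) → Vec d}
    (ha : ∀ i, a i ∈ A) (hb : ∀ i, b i ∈ A) :
    ∃ x : Fin (k - 1) → Fin d, (∀ i : Fin (k - 1), PropL1 k d ((i : ℕ) + 1) (a i) x) ∧
      ∀ i : Fin (k - 1), PropLk k d ((i : ℕ) + 2) (b i) x := by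
  have key (j : Fin (k - 1)) : ∃ y : Fin d,
      (∀ i : Fin (k - 1), (j : ℕ) + 1 ≤ k - ((i : ℕ) + 1) → a i y = true) ∧
      ∀ i : Fin (k - 1), k + 1 - ((i : ℕ) + 2) ≤ (j : ℕ) + 1 → b i y = true := by
    obtain ⟨y, hy⟩ := h
      (fun m => if hm : (m : ℕ) < k - 1 - j then a ⟨m, by omega⟩ else b ⟨m - 1, by omega⟩)
      (fun m => by split_ifs <;> simp only [ha, hb])
    refine ⟨y, fun i hi => ?_, fun i hi => ?_⟩
    · have := hy ⟨i, by omega⟩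
      rwa [dif_pos (show (i : ℕ) < k - 1 - j by omega)] at this
    · have := hy ⟨i + 1, by omega⟩
      rwa [dif_neg (show ¬ (i : ℕ) + 1 < k - 1 - j by omega)] at this
  choose x hx using key
  exact ⟨x, fun i j hj => (hx j).1 i hj, fun i j hj => (hx j).2 i hj⟩

lemma IsVertex.exists_edgeCore_to_first {k d : ℕ} {A : Finset (Vec d)} {u : OVVert k d}
    (hu : IsVertex k d A u) (hk : 3 ≤ k) (hA : A.Nonempty) :
    ∃ a : Fin (k - 1) → Vec d, (∀ i, a i ∈ A) ∧
      ∀ x, (∀ i : Fin (k - 1), PropL1 k d ((i : ℕ) + 1) (a i) x) →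
        EdgeCore k d hk u (Sum.inr (1, fun j => a (Fin.castLE (by omega) j), x)) := by
  rcases u with a | ⟨i, a, y⟩
  · exact ⟨a, hu, fun x hx => Or.inl ⟨a, _, x, rfl, rfl, fun _ => rfl,
      hx ⟨k - 2, by omega⟩ ⟨0, by omega⟩ (by dsimp only; omega)⟩⟩
  · obtain ⟨c, hc⟩ := hA
    obtain ⟨h1, h2, ha, -⟩ := hu
    refine ⟨fun m => if hm : (m : ℕ) < k - 2 then a ⟨m, hm⟩ else c,
      fun m => by dsimp only; split_ifs <;> simp only [ha, hc], fun x _ => ?_⟩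
    refine Or.inr <| Or.inr <| Or.inr <| Or.inl ⟨i, a, y, x, h1, h2, rfl, ?_⟩
    simp

lemma IsVertex.exists_edgeCore_from_last {k d : ℕ} {A : Finset (Vec d)} {v : OVVert k d}
    (hv : IsVertex k d A v) (hk : 3 ≤ k) (hA : A.Nonempty) :
    ∃ b : Fin (k - 1) → Vec d, (∀ i, b i ∈ A) ∧
      ∀ x, (∀ i : Fin (k - 1), PropLk k d ((i : ℕ) + 2) (b i) x) →
        EdgeCore k d hk
          (Sum.inr (k - 1, fun j : Fin (k - 2) => b ⟨(j : ℕ) + 1, by omega⟩, x)) v := by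
  rcases v with b | ⟨i, b, y⟩
  · exact ⟨b, hv, fun x hx => Or.inr <| Or.inl ⟨_, x, b, rfl, rfl, fun _ => rfl,
      hx ⟨0, by omega⟩ ⟨k - 2, by omega⟩ (by dsimp only; omega)⟩⟩
  · obtain ⟨c, hc⟩ := hA
    obtain ⟨h1, h2, hb, -⟩ := hv
    refine ⟨fun m => if hm : 1 ≤ (m : ℕ) then b ⟨m - 1, by omega⟩ else c,
      fun m => by dsimp only; split_ifs <;> simp only [hb, hc], fun x _ => ?_⟩
    refine Or.inr <| Or.inr <| Or.inr <| Or.inr ⟨i, b, x, y, h1, h2, ?_, rfl⟩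
    simp

/-- The vector tuple at layer `t` on the path from `L₁` to `L_{k-1}`. -/
def pathTuple {k d : ℕ} (a b : Fin (k - 1) → Vec d) (t : ℕ) : Fin (k - 2) → Vec d :=
  fun j => if (j : ℕ) < k - 1 - t then a (Fin.castLE (by omega) j)
    else b ⟨(j : ℕ) + 1, by omega⟩

lemma pathTuple_one {k d : ℕ} (a b : Fin (k - 1) → Vec d) :
    pathTuple a b 1 = fun j => a (Fin.castLE (by omega) j) :=
  funext fun j => if_pos (by omega)

lemma pathTuple_last {k d : ℕ} (a b : Fin (k - 1) → Vec d) :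
    pathTuple a b (k - 1) = fun j : Fin (k - 2) => b ⟨(j : ℕ) + 1, by omega⟩ :=
  funext fun j => if_neg (by omega)

lemma isVertex_pathTuple {k d : ℕ} {A : Finset (Vec d)} {a b : Fin (k - 1) → Vec d}
    {x : Fin (k - 1) → Fin d} (ha : ∀ i, a i ∈ A) (hb : ∀ i, b i ∈ A)
    (hxa : ∀ i : Fin (k - 1), PropL1 k d ((i : ℕ) + 1) (a i) x)
    (hxb : ∀ i : Fin (k - 1), PropLk k d ((i : ℕ) + 2) (b i) x) {t : ℕ} (h1 : 1 ≤ t) (h2 : t ≤ k - 1) :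
    IsVertex k d A (Sum.inr (t, pathTuple a b t, x)) := by
  refine ⟨h1, h2, fun j => ?_, ?_, ?_⟩
  · unfold pathTuple
    split_ifs <;> simp only [ha, hb]
  · rintro rfl
    rw [pathTuple_one]
    exact fun j => hxa (Fin.castLE (by omega) j)
  · rintro rfl
    rw [pathTuple_last]
    exact fun j => hxb ⟨j + 1, by omega⟩

lemma edgeCore_pathTuple {k d : ℕ} (hk : 3 ≤ k) (a b : Fin (k - 1) → Vec d)
    (x : Fin (k - 1) → Fin d) {t : ℕ} (h1 : 1 ≤ t) (h2 : t ≤ k - 2) :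
    EdgeCore k d hk (Sum.inr (t, pathTuple a b t, x))
      (Sum.inr (t + 1, pathTuple a b (t + 1), x)) := by
  refine Or.inr <| Or.inr <| Or.inl ⟨t, _, _, x, h1, h2, rfl, rfl, fun j hj => ?_⟩
  have : (j : ℕ) < k - 1 - t ↔ (j : ℕ) < k - 1 - (t + 1) := by omega
  simp only [pathTuple, this]

end OVDiam

open OVDiam in
/-- If `A` is nonempty and has no Single-Set k-OV solution, then every
ordered pair of vertices of `G(A,k,d)` is joined by a directed walk with exactly `k`
edges (so `G(A,k,d)` has diameter at most `k`). -/
theorem stmt5 (k d : ℕ) (hk : 3 ≤ k) (hd : 1 ≤ d) (A : Finset (Vec d)) (hA : A.Nonempty)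
    (hnosol : NoSingleSetSolution k d A) :
    ∀ u v : OVVert k d, IsVertex k d A u → IsVertex k d A v →
      HasWalk k d hk A u v k := by
  intro u v hu hv
  obtain ⟨a, ha, hua⟩ := hu.exists_edgeCore_to_first hk hA
  obtain ⟨b, hb, hbv⟩ := hv.exists_edgeCore_from_last hk hA
  obtain ⟨x, hxa, hxb⟩ := hnosol.exists_index hk ha hb
  have hvert {t : ℕ} (h1 : 1 ≤ t) (h2 : t ≤ k - 1) :=
    isVertex_pathTuple ha hb hxa hxb h1 h2
  have hfirst := hua x hxa
  rw [← pathTuple_one a b] at hfirst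
  have hlast := hbv x hxb
  rw [← pathTuple_last a b] at hlast
  refine ⟨fun t => if t = 0 then u else if t = k then v else Sum.inr (t, pathTuple a b t, x),
    if_pos rfl, by dsimp only; rw [if_neg (by omega), if_pos rfl], fun t ht => ?_⟩
  dsimp only
  rw [if_neg (Nat.succ_ne_zero t)]
  rcases Nat.eq_zero_or_pos t with rfl | h0
  · rw [if_pos rfl, if_neg (by omega)]
    exact ⟨hu, hvert le_rfl (by omega), hfirst⟩
  rw [if_neg h0.ne', if_neg ht.ne]
  rcases Nat.lt_or_ge (t + 1) k with h | h
  · rw [if_neg h.ne]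
    exact ⟨hvert h0 (by omega), hvert (by omega) (by omega),
      edgeCore_pathTuple hk a b x h0 (by omega)⟩
  · obtain rfl : t = k - 1 := by omega
    rw [if_pos (by omega)]
    exact ⟨hvert h0 le_rfl, hv, hlast⟩
end

section
/- Suppose a_1, …, a_k ∈ A satisfy (a_1,…,a_{k−1}) ≠ (a_2,…,a_k) and, for every coordinate x ∈ {1,…,d}, a_i[x] = 0 for some i ∈ {1,…,k} (i.e., the vectors a_1, …, a_k are orthogonal). Then in the k-OV Diameter graph G(A,k,d) there is no directed walk with at most 2k−2 edges from the vertex (a_1,…,a_{k−1}) ∈ L_0 to the vertex (a_2,…,a_k) ∈ L_0; in particular, the distance from (a_1,…,a_{k−1}) to (a_2,…,a_k) is at least 2k−1. -/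
namespace OVDiam

/-- The index of the layer containing a vertex. -/
def layer {k d : ℕ} : OVVert k d → ℕ
  | Sum.inl _ => 0
  | Sum.inr p => p.1

/-- An edge raises the layer index by at most one. -/
lemma Edge.layer_le {k d : ℕ} {hk : 3 ≤ k} {A : Finset (Vec d)} {u v : OVVert k d}
    (h : Edge k d hk A u v) : layer v ≤ layer u + 1 := by
  obtain ⟨-, -, h⟩ := h
  rcases h with ⟨_, _, _, rfl, rfl, -⟩ | ⟨_, _, _, rfl, rfl, -⟩ | ⟨_, _, _, _, -, -, rfl, rfl, -⟩ |
    ⟨_, _, _, _, -, -, rfl, rfl⟩ | ⟨_, _, _, _, -, _, rfl, rfl⟩ <;> simp only [layer] <;> omega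

/-- Every edge into `L₀` starts in `L_{k-1}`. -/
lemma Edge.layer_eq_of_inl {k d : ℕ} {hk : 3 ≤ k} {A : Finset (Vec d)} {u : OVVert k d}
    {b : Fin (k - 1) → Vec d} (h : Edge k d hk A u (Sum.inl b)) : layer u = k - 1 := by
  obtain ⟨-, -, h⟩ := h
  rcases h with ⟨_, _, _, rfl, h, -⟩ | ⟨_, _, _, rfl, h, -⟩ | ⟨_, _, _, _, -, -, rfl, h, -⟩ |
    ⟨_, _, _, _, -, -, rfl, h⟩ | ⟨_, _, _, _, -, -, rfl, h⟩ <;> simp_all [layer]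

/-- Two visits of a walk to `L₀` are at least `k` steps apart. -/
lemma add_le_of_inl_of_inl {k d : ℕ} {hk : 3 ≤ k} {A : Finset (Vec d)} {w : ℕ → OVVert k d}
    {ℓ : ℕ} (hw : ∀ t, t < ℓ → Edge k d hk A (w t) (w (t + 1))) {p q : ℕ} (hpq : p < q)
    (hq : q ≤ ℓ) {b c : Fin (k - 1) → Vec d} (hb : w p = Sum.inl b) (hc : w q = Sum.inl c) :
    p + k ≤ q := by
  have key : ∀ n, p + n ≤ ℓ → layer (w (p + n)) ≤ n := by
    intro n
    induction n with
    | zero => intro _; simp [hb, layer]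
    | succ n ih =>
      intro hn
      have := (hw (p + n) (by omega)).layer_le
      have := ih (by omega)
      rw [← add_assoc]
      omega
  have h1 := hw (q - 1) (by omega)
  rw [show q - 1 + 1 = q by omega, hc] at h1
  have h2 := h1.layer_eq_of_inl
  have h3 := key (q - 1 - p) (by omega)
  rw [show p + (q - 1 - p) = q - 1 by omega] at h3
  omega

/-- The edges between vertices outside `L₀`, in terms of layers, vectors and coordinates. -/
def InnerStep (k d : ℕ) (p q : ℕ × (Fin (k - 2) → Vec d) × (Fin (k - 1) → Fin d)) : Prop :=
  (1 ≤ p.1 ∧ p.1 ≤ k - 2 ∧ q.1 = p.1 + 1 ∧ q.2.2 = p.2.2 ∧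
    ∀ j : Fin (k - 2), (j : ℕ) ≠ k - 2 - p.1 → p.2.1 j = q.2.1 j) ∨
  ((q.1 = 1 ∨ p.1 = k - 1) ∧ 1 ≤ p.1 ∧ p.1 ≤ k - 1 ∧ 1 ≤ q.1 ∧ q.1 ≤ k - 1 ∧ q.2.1 = p.2.1)

lemma Edge.innerStep {k d : ℕ} {hk : 3 ≤ k} {A : Finset (Vec d)}
    {p q : ℕ × (Fin (k - 2) → Vec d) × (Fin (k - 1) → Fin d)}
    (h : Edge k d hk A (Sum.inr p) (Sum.inr q)) : InnerStep k d p q := by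
  obtain ⟨-, -, h⟩ := h
  rcases h with ⟨_, _, _, h, -⟩ | ⟨_, _, _, -, h, -⟩ | ⟨_, _, _, _, h1, h2, hp, hq, hj⟩ |
    ⟨_, _, _, _, h1, h2, hp, hq⟩ | ⟨_, _, _, _, h1, h2, hp, hq⟩
  · cases h
  · cases h
  all_goals
    cases Sum.inr_injective hp
    cases Sum.inr_injective hq
  · exact Or.inl ⟨h1, h2, rfl, rfl, hj⟩
  · exact Or.inr ⟨Or.inl rfl, h1, h2, le_rfl, by omega, rfl⟩
  · exact Or.inr ⟨Or.inr rfl, by omega, le_rfl, h1, h2, rfl⟩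

section InnerWalk

variable {k d n : ℕ} {P : ℕ → ℕ × (Fin (k - 2) → Vec d) × (Fin (k - 1) → Fin d)}

/-- Returning to `L₁` after `s` steps from `L₁` keeps the vectors of small index. -/
lemma inner_eq_of_returns (hP : ∀ u < n, InnerStep k d (P u) (P (u + 1))) (h0 : (P 0).1 = 1)
    {s : ℕ} (hs : s ≤ n) (hs1 : (P s).1 = 1) (j : Fin (k - 2)) (hj : (j : ℕ) + 1 + s ≤ k - 1) :
    (P s).2.1 j = (P 0).2.1 j := by
  have key : ∀ u, u ≤ s → (P u).1 ≤ u + 1 ∧ (P u).2.1 j = (P 0).2.1 j := by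
    intro u
    induction u with
    | zero => intro _; exact ⟨by omega, rfl⟩
    | succ u ih =>
      intro hu
      obtain ⟨h1, h2⟩ := ih (by omega)
      rcases hP u (by omega) with ⟨ha, hb, hc, -, he⟩ | ⟨ha, hb, hc, hd, he, hf⟩
      · have : u + 1 ≠ s := by rintro rfl; omega
        exact ⟨by omega, by rw [← he j (by omega), h2]⟩
      · exact ⟨by omega, by rw [hf, h2]⟩
  exact (key s le_rfl).2

/-- Returning to `L_{k-1}` from `L_{k-1}` keeps the vectors of large index. -/
lemma inner_eq_of_returns_last (hP : ∀ u < n, InnerStep k d (P u) (P (u + 1)))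
    (hn : (P n).1 = k - 1) {T : ℕ} (hT : T ≤ n) (hT1 : (P T).1 = k - 1) (hk : 3 ≤ k)
    (j : Fin (k - 2)) (hj : n - T ≤ (j : ℕ) + 1) :
    (P T).2.1 j = (P n).2.1 j := by
  have key : ∀ r, T + r ≤ n → k - 1 ≤ (P (n - r)).1 + r ∧ (P (n - r)).2.1 j = (P n).2.1 j := by
    intro r
    induction r with
    | zero => intro _; simp [hn]
    | succ r ih =>
      intro hr
      obtain ⟨h1, h2⟩ := ih (by omega)
      have hstep := hP (n - (r + 1)) (by omega)
      rw [show n - (r + 1) + 1 = n - r by omega] at hstep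
      rcases hstep with ⟨ha, hb, hc, -, he⟩ | ⟨ha, hb, hc, hd, he, hf⟩
      · have : n - (r + 1) ≠ T := by intro h; rw [h] at hb; omega
        exact ⟨by omega, by rw [he j (by omega), h2]⟩
      · exact ⟨by omega, by rw [← hf, h2]⟩
  have := (key (n - T) (by omega)).2
  rwa [show n - (n - T) = T by omega] at this

/-- A walk from `L₁` to `L_{k-1}` avoiding `L₀` contains a direct passage from `L₁` to `L_{k-1}`
along which the coordinates stay fixed. -/
lemma exists_direct_passage (hk : 3 ≤ k) (hP : ∀ u < n, InnerStep k d (P u) (P (u + 1)))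
    (h0 : (P 0).1 = 1) (hn : (P n).1 = k - 1) :
    ∃ s, s + (k - 2) ≤ n ∧ (P s).1 = 1 ∧ (P (s + (k - 2))).1 = k - 1 ∧
      (P (s + (k - 2))).2.2 = (P s).2.2 := by
  classical
  have hex : ∃ T, (P T).1 = k - 1 := ⟨n, hn⟩
  set T := Nat.find hex
  have hT : (P T).1 = k - 1 := Nat.find_spec hex
  have hTmin : ∀ u < T, (P u).1 ≠ k - 1 := fun u hu => Nat.find_min hex hu
  have hTn : T ≤ n := Nat.find_min' hex hn
  set s := Nat.findGreatest (fun u => (P u).1 = 1) T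
  have hs : (P s).1 = 1 := Nat.findGreatest_spec (P := fun u => (P u).1 = 1) (Nat.zero_le T) h0
  have hsT : s ≤ T := Nat.findGreatest_le T
  have hsmax : ∀ u, s < u → u ≤ T → (P u).1 ≠ 1 := fun u h1 h2 =>
    Nat.findGreatest_is_greatest (P := fun u => (P u).1 = 1) h1 h2
  have key : ∀ v, s + v ≤ T → (P (s + v)).1 = v + 1 ∧ (P (s + v)).2.2 = (P s).2.2 := by
    intro v
    induction v with
    | zero => intro _; simp [hs]
    | succ v ih =>
      intro hv
      obtain ⟨h1, h2⟩ := ih (by omega)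
      have hm := hsmax (s + (v + 1)) (by omega) hv
      have hm' := hTmin (s + v) (by omega)
      rcases hP (s + v) (by omega) with ⟨ha, hb, hc, hd, -⟩ | ⟨ha | ha, -⟩
      · rw [← add_assoc]
        exact ⟨by omega, by rw [hd, h2]⟩
      · exact absurd ha hm
      · exact absurd ha hm'
  obtain ⟨h1, h2⟩ := key (T - s) (by omega)
  rw [show s + (T - s) = T by omega] at h1 h2
  have hTs : s + (k - 2) = T := by omega
  exact ⟨s, by omega, hs, by rw [hTs, hT], by rw [hTs, h2]⟩

end InnerWalk

end OVDiam

open OVDiam in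
/-- If `a₁,…,a_k ∈ A` satisfy `(a₁,…,a_{k−1}) ≠ (a₂,…,a_k)` and are
orthogonal (every coordinate has some `aᵢ[x] = 0`), then there is no directed walk
with at most `2k−2` edges from the vertex `(a₁,…,a_{k−1}) ∈ L₀` to the vertex
`(a₂,…,a_k) ∈ L₀` of `G(A,k,d)`. -/
theorem stmt6 (k d : ℕ) (hk : 3 ≤ k) (hd : 1 ≤ d) (A : Finset (Vec d))
    (a : Fin k → Vec d) (ha : ∀ i, a i ∈ A)
    (hne : (fun j : Fin (k - 1) => a (Fin.castLE (Nat.sub_le k 1) j)) ≠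
           (fun j : Fin (k - 1) => a ⟨(j : ℕ) + 1, by have := j.isLt; omega⟩))
    (horth : ∀ x : Fin d, ∃ i : Fin k, a i x = false) :
    ∀ ℓ ≤ 2 * k - 2,
      ¬ HasWalk k d hk A
          (Sum.inl (fun j : Fin (k - 1) => a (Fin.castLE (Nat.sub_le k 1) j)))
          (Sum.inl (fun j : Fin (k - 1) => a ⟨(j : ℕ) + 1, by have := j.isLt; omega⟩))
          ℓ := by
  rintro ℓ hℓ ⟨w, hw0, hwℓ, hw⟩
  have hℓ0 : 0 < ℓ := by
    rcases Nat.eq_zero_or_pos ℓ with rfl | h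
    · exact absurd (Sum.inl_injective (hw0.symm.trans hwℓ)) hne
    · exact h
  have hkℓ : 0 + k ≤ ℓ := add_le_of_inl_of_inl hw hℓ0 le_rfl hw0 hwℓ
  have hinner : ∀ u, 0 < u → u < ℓ → ∃ p, w u = Sum.inr p := by
    intro u hu huℓ
    rcases hwu : w u with b | p
    · have := add_le_of_inl_of_inl hw hu huℓ.le hw0 hwu
      have := add_le_of_inl_of_inl hw huℓ le_rfl hwu hwℓ
      omega
    · exact ⟨p, rfl⟩
  obtain ⟨n, rfl⟩ : ∃ n, ℓ = n + 2 := ⟨ℓ - 2, by omega⟩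
  have hinner' : ∀ u, ∃ p, u ≤ n → w (u + 1) = Sum.inr p := by
    intro u
    by_cases hu : u ≤ n
    · obtain ⟨p, hp⟩ := hinner (u + 1) (by omega) (by omega)
      exact ⟨p, fun _ => hp⟩
    · obtain ⟨p, -⟩ := hinner 1 (by omega) (by omega)
      exact ⟨p, fun h => absurd h hu⟩
  choose P hPw using hinner'
  have hP : ∀ u < n, InnerStep k d (P u) (P (u + 1)) := by
    intro u hu
    have h := hw (u + 1) (by omega)
    rw [hPw u hu.le, hPw (u + 1) hu] at h
    exact h.innerStep
  have hV : ∀ u ≤ n, IsVertex k d A (Sum.inr (P u)) := by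
    intro u hu
    rw [← hPw u hu]
    exact (hw (u + 1) (by omega)).1
  have hstart : (P 0).1 = 1 ∧
      (∀ j : Fin (k - 2), (P 0).2.1 j = a ⟨j, by have := j.isLt; omega⟩) ∧
      a ⟨k - 2, by omega⟩ ((P 0).2.2 ⟨0, by omega⟩) = true := by
    have h := (hw 0 (by omega)).2.2
    rw [hw0, hPw 0 (by omega)] at h
    rcases h with ⟨_, _, _, h1, h2, h3, h4⟩ | ⟨_, _, _, h, -⟩ | ⟨_, _, _, _, -, -, h, -⟩ |
      ⟨_, _, _, _, -, -, h, -⟩ | ⟨_, _, _, _, -, -, h, -⟩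
    · cases Sum.inl_injective h1
      rw [Sum.inr_injective h2]
      exact ⟨rfl, h3, h4⟩
    all_goals cases h
  have hend : (P n).1 = k - 1 ∧
      (∀ j : Fin (k - 2), (P n).2.1 j = a ⟨(j : ℕ) + 2, by have := j.isLt; omega⟩) ∧
      a ⟨1, by omega⟩ ((P n).2.2 ⟨k - 2, by omega⟩) = true := by
    have h := (hw (n + 1) (by omega)).2.2
    rw [hwℓ, hPw n le_rfl] at h
    rcases h with ⟨_, _, _, -, h, -⟩ | ⟨_, _, _, h1, h2, h3, h4⟩ | ⟨_, _, _, _, -, -, -, h, -⟩ |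
      ⟨_, _, _, _, -, -, -, h⟩ | ⟨_, _, _, _, -, -, -, h⟩
    · cases h
    · cases Sum.inl_injective h2
      rw [Sum.inr_injective h1]
      exact ⟨rfl, h3, h4⟩
    all_goals cases h
  obtain ⟨h0, hB0, hx0⟩ := hstart
  obtain ⟨hn, hBn, hxn⟩ := hend
  obtain ⟨s, hsn, hs1, hT1, hX⟩ := exists_direct_passage hk hP h0 hn
  have hsk : s < k - 1 := by omega
  obtain ⟨i, hi⟩ := horth ((P s).2.2 ⟨s, hsk⟩)
  obtain ⟨i, hik⟩ := i
  refine Bool.false_ne_true (hi.symm.trans ?_)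
  by_cases hcase : i + 1 + s ≤ k - 1
  · by_cases hi2 : i < k - 2
    · have h1 := inner_eq_of_returns hP h0 (by omega) hs1 ⟨i, hi2⟩ hcase
      have h2 := (hV s (by omega)).2.2.2.1 hs1 ⟨i, hi2⟩ ⟨s, hsk⟩ (by simp only; omega)
      rwa [h1, hB0] at h2
    · obtain rfl : i = k - 2 := by omega
      obtain rfl : s = 0 := by omega
      exact hx0
  · by_cases hi1 : i = 1
    · subst hi1
      obtain rfl : s = k - 2 := by omega
      obtain rfl : n = k - 2 + (k - 2) := by omega
      rwa [hX] at hxn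
    · have h1 := inner_eq_of_returns_last hP hn hsn hT1 hk ⟨i - 2, by omega⟩
        (by simp only; omega)
      have h2 := (hV (s + (k - 2)) hsn).2.2.2.2 hT1 ⟨i - 2, by omega⟩ ⟨s, hsk⟩
        (by simp only; omega)
      rw [h1, hBn, hX] at h2
      simpa only [show i - 2 + 2 = i by omega] using h2
end

section
/- Let k ≥ 2 be an integer and let ℓ be an integer with 1 ≤ ℓ ≤ k−1. Let G be a finite strongly connected directed weighted graph with n ≥ 2 vertices and m edges whose edge weights all lie in the interval [1, W_max], and suppose that d(u,v) ≤ D for every pair of vertices u, v, where D > 0. Let r > 0 be a real number. Then either there exists a vertex subset X with |X| ≤ 8·m^{1−ℓ/k}·W_max·log m such that d(X,v) ≤ (ℓ/k)·D + r for every vertex v, or there exists a vertex subset X′ with |X′| ≤ 8·m^{ℓ/k}·(log m)/r such that d(v,X′) ≤ ((k−ℓ)/k)·D for every vertex v. -/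
namespace Stmt7

/-- A finite directed weighted graph: an edge relation on the (finite) vertex type
together with a positive real weight on each edge. -/
structure DWGraph (V : Type*) where
  Edge : V → V → Prop
  w : V → V → ℝ
  w_pos : ∀ u v, Edge u v → 0 < w u v

variable {V : Type*}

/-- `l` is a directed walk from `u` to `v`. -/
def IsWalk (G : DWGraph V) (u v : V) (l : List V) : Prop :=
  l.head? = some u ∧ l.getLast? = some v ∧ l.Chain' G.Edge

/-- The length (total weight) of a walk. -/
def walkCost (G : DWGraph V) (l : List V) : ℝ :=
  ((l.zip l.tail).map fun p => G.w p.1 p.2).sum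

/-- Every ordered pair of vertices is joined by a directed walk. -/
def StronglyConnected (G : DWGraph V) : Prop :=
  ∀ u v : V, ∃ l : List V, IsWalk G u v l

/-- Shortest-path distance. -/
noncomputable def gdist (G : DWGraph V) (u v : V) : ℝ :=
  sInf {c : ℝ | ∃ l : List V, IsWalk G u v l ∧ walkCost G l = c}

theorem isWalk_singleton (G : DWGraph V) (v : V) : IsWalk G v v [v] := by
  exact ⟨rfl, rfl, List.isChain_singleton v⟩

theorem IsWalk.cons {G : DWGraph V} {x y v : V} (h : G.Edge x y) {l : List V}
    (hl : IsWalk G y v l) : IsWalk G x v (x :: l) ∧ walkCost G (x :: l) = G.w x y + walkCost G l := by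
  obtain ⟨h1, h2, h3⟩ := hl
  cases l with
  | nil => simp at h1
  | cons z l =>
    simp only [List.head?_cons, Option.some.injEq] at h1
    subst h1
    refine ⟨⟨rfl, ?_, ?_⟩, ?_⟩
    · simpa [List.getLast?_cons_cons] using h2
    · exact List.isChain_cons_cons.2 ⟨h, h3⟩
    · simp [walkCost]

/-- Induction along a directed walk, from its end to its start. -/
theorem IsWalk.rec_cons {G : DWGraph V} {v : V} {P : V → ℝ → Prop} (h0 : P v 0)
    (hs : ∀ x y l, G.Edge x y → IsWalk G y v l → P y (walkCost G l) →
      P x (G.w x y + walkCost G l)) :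
    ∀ (l : List V) (u : V), IsWalk G u v l → P u (walkCost G l)
  | [], u, h => by simp [IsWalk] at h
  | [a], u, h => by
    obtain ⟨h1, h2, -⟩ := h
    simp only [List.head?_cons, Option.some.injEq, List.getLast?_singleton] at h1 h2
    subst h1 h2
    simpa [walkCost] using h0
  | a :: b :: l, u, h => by
    obtain ⟨h1, h2, h3⟩ := h
    simp only [List.head?_cons, Option.some.injEq] at h1
    subst h1
    have h3' := List.isChain_cons_cons.1 h3
    have hw : IsWalk G b v (b :: l) :=
      ⟨rfl, by simpa [List.getLast?_cons_cons] using h2, h3'.2⟩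
    have := hs a b (b :: l) h3'.1 hw (IsWalk.rec_cons h0 hs (b :: l) b hw)
    rwa [← (hw.cons h3'.1).2] at this

theorem walkCost_nonneg {G : DWGraph V} {u v : V} {l : List V} (h : IsWalk G u v l) :
    0 ≤ walkCost G l :=
  IsWalk.rec_cons (P := fun _ c => 0 ≤ c) le_rfl
    (fun x y _ he _ hc => add_nonneg (G.w_pos x y he).le hc) l u h

theorem gdist_le {G : DWGraph V} {u v : V} {l : List V} (h : IsWalk G u v l) :
    gdist G u v ≤ walkCost G l :=
  csInf_le (a := walkCost G l) ⟨0, by rintro _ ⟨l, hl, rfl⟩; exact walkCost_nonneg hl⟩ ⟨l, h, rfl⟩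

theorem gdist_nonneg (G : DWGraph V) (u v : V) : 0 ≤ gdist G u v :=
  Real.sInf_nonneg (by rintro _ ⟨l, hl, rfl⟩; exact walkCost_nonneg hl)

theorem gdist_self (G : DWGraph V) (v : V) : gdist G v v = 0 :=
  le_antisymm (by simpa [walkCost] using gdist_le (isWalk_singleton G v)) (gdist_nonneg G v v)

theorem exists_walkCost_lt {G : DWGraph V} (hconn : StronglyConnected G) (u v : V) {c : ℝ}
    (h : gdist G u v < c) : ∃ l, IsWalk G u v l ∧ walkCost G l < c := by
  obtain ⟨l, hl⟩ := hconn u v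
  obtain ⟨_, ⟨l, hl, rfl⟩, hc⟩ := exists_lt_of_csInf_lt
    (s := {c : ℝ | ∃ l : List V, IsWalk G u v l ∧ walkCost G l = c}) ⟨walkCost G l, l, hl, rfl⟩ h
  exact ⟨l, hl, hc⟩

theorem gdist_le_add {G : DWGraph V} (hconn : StronglyConnected G) {x y : V} (h : G.Edge x y)
    (v : V) : gdist G x v ≤ G.w x y + gdist G y v := by
  refine le_of_forall_pos_le_add fun ε hε => ?_
  obtain ⟨l, hl, hc⟩ := exists_walkCost_lt hconn y v (lt_add_of_pos_right _ hε)
  have h1 := gdist_le (hl.cons h).1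
  rw [(hl.cons h).2] at h1
  linarith

/-- A walk towards `v` that starts at distance at least `ρ` from `v` crosses level `ρ`. -/
theorem IsWalk.exists_crossing {G : DWGraph V} (hconn : StronglyConnected G) {v : V} {ρ : ℝ}
    (hρ : 0 < ρ) {l : List V} {u : V} (hl : IsWalk G u v l) (hu : ρ ≤ gdist G u v) :
    ∃ x y, G.Edge x y ∧ gdist G y v < ρ ∧ ρ ≤ gdist G x v ∧ gdist G u x ≤ walkCost G l - ρ := by
  refine IsWalk.rec_cons (P := fun u c => ρ ≤ gdist G u v → ∃ x y, G.Edge x y ∧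
    gdist G y v < ρ ∧ ρ ≤ gdist G x v ∧ gdist G u x ≤ c - ρ) ?_ ?_ l u hl hu
  · intro h
    rw [gdist_self] at h
    linarith
  · intro a b l hab hw ih ha
    by_cases hb : ρ ≤ gdist G b v
    · obtain ⟨x, y, h1, h2, h3, h4⟩ := ih hb
      exact ⟨x, y, h1, h2, h3, by linarith [gdist_le_add hconn hab x]⟩
    · refine ⟨a, b, hab, not_le.1 hb, ha, ?_⟩
      have h1 := gdist_le (hw.cons hab).1
      rw [(hw.cons hab).2] at h1
      rw [gdist_self]
      linarith

theorem exists_crossing [Finite V] {G : DWGraph V} (hconn : StronglyConnected G) {u v : V} {ρ : ℝ}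
    (hρ : 0 < ρ) (hu : ρ ≤ gdist G u v) :
    ∃ x y, G.Edge x y ∧ gdist G y v < ρ ∧ ρ ≤ gdist G x v ∧ gdist G u x ≤ gdist G u v - ρ := by
  have hS := Set.toFinite {x | ∃ y, G.Edge x y ∧ gdist G y v < ρ ∧ ρ ≤ gdist G x v}
  have key : ∀ ε > 0, ∃ x ∈ {x | ∃ y, G.Edge x y ∧ gdist G y v < ρ ∧ ρ ≤ gdist G x v},
      gdist G u x ≤ gdist G u v - ρ + ε := by
    intro ε hε
    obtain ⟨l, hl, hc⟩ := exists_walkCost_lt hconn u v (lt_add_of_pos_right _ hε)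
    obtain ⟨x, y, h1, h2, h3, h4⟩ := hl.exists_crossing hconn hρ hu
    exact ⟨x, ⟨y, h1, h2, h3⟩, by linarith⟩
  obtain ⟨x₀, hx₀, -⟩ := key 1 one_pos
  obtain ⟨x, ⟨y, h1, h2, h3⟩, hmin⟩ := Set.exists_min_image _ (fun x => gdist G u x) hS ⟨x₀, hx₀⟩
  refine ⟨x, y, h1, h2, h3, le_of_forall_pos_le_add fun ε hε => ?_⟩
  obtain ⟨z, hz, hzε⟩ := key ε hε
  exact (hmin z hz).trans hzε

/-- Greedy hitting sets: if every `S v` contains at least a `p`-fraction of `E`, then `t` elements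
of `E` can be chosen so that at most a `(1 - p) ^ t`-fraction of the sets is not hit. -/
theorem exists_greedy_hitting {ι α : Type*} [Fintype ι] [DecidableEq α] (E : Finset α)
    (S : ι → Finset α) (hSE : ∀ v, S v ⊆ E) {p : ℝ} (hp : p ≤ 1)
    (hE : E.Nonempty) (hS : ∀ v, p * E.card ≤ (S v).card) (t : ℕ) :
    ∃ F : Finset α, F.card ≤ t ∧
      ((Finset.univ.filter fun v => Disjoint (S v) F).card : ℝ) ≤ Fintype.card ι * (1 - p) ^ t := by
  induction t with
  | zero => exact ⟨∅, by simp, by simp⟩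
  | succ t ih =>
    obtain ⟨F, hF, hU⟩ := ih
    set U := Finset.univ.filter fun v => Disjoint (S v) F with hUdef
    obtain ⟨e, he, hcard⟩ : ∃ e ∈ E, p * U.card ≤ ((U.filter fun v => e ∈ S v).card : ℝ) := by
      by_contra! hcon
      have h1 : ∑ e ∈ E, ((U.filter fun v => e ∈ S v).card : ℝ) < ∑ _e ∈ E, p * U.card :=
        Finset.sum_lt_sum_of_nonempty hE hcon
      have h2 : ∑ e ∈ E, (U.filter fun v => e ∈ S v).card = ∑ v ∈ U, (S v).card := by
        have := Finset.sum_card_bipartiteAbove_eq_sum_card_bipartiteBelow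
          (s := E) (t := U) (fun e v => e ∈ S v)
        simp only [Finset.bipartiteAbove, Finset.bipartiteBelow] at this
        rw [this]
        refine Finset.sum_congr rfl fun v _ => ?_
        rw [Finset.filter_mem_eq_inter, Finset.inter_eq_right.2 (hSE v)]
      have h3 : ∑ _v ∈ U, p * E.card ≤ ∑ v ∈ U, ((S v).card : ℝ) :=
        Finset.sum_le_sum fun v _ => hS v
      have h4 : ∑ e ∈ E, ((U.filter fun v => e ∈ S v).card : ℝ) = ∑ v ∈ U, ((S v).card : ℝ) := by
        exact_mod_cast h2
      simp only [Finset.sum_const, nsmul_eq_mul] at h1 h3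
      rw [h4] at h1
      nlinarith
    refine ⟨insert e F, (Finset.card_insert_le _ _).trans (by lia), ?_⟩
    have hsub : (Finset.univ.filter fun v => Disjoint (S v) (insert e F)) =
        U.filter fun v => ¬ e ∈ S v := by
      ext v
      simp [hUdef, Finset.disjoint_insert_right, and_comm]
    have hsplit := Finset.card_filter_add_card_filter_not (s := U) (fun v => e ∈ S v)
    have hsplit' : ((U.filter fun v => e ∈ S v).card : ℝ) +
        ((U.filter fun v => ¬ e ∈ S v).card : ℝ) = U.card := by exact_mod_cast hsplit
    rw [hsub]
    calc ((U.filter fun v => ¬ e ∈ S v).card : ℝ) ≤ U.card * (1 - p) := by linarith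
      _ ≤ Fintype.card ι * (1 - p) ^ t * (1 - p) :=
        mul_le_mul_of_nonneg_right hU (by linarith)
      _ = _ := by ring

theorem exists_hitting_set {ι α : Type*} [Fintype ι] [Nonempty ι] [DecidableEq α] (E : Finset α)
    (S : ι → Finset α) (hSE : ∀ v, S v ⊆ E) {p : ℝ} (hp0 : 0 < p) (hp : p ≤ 1)
    (hE : E.Nonempty) (hS : ∀ v, p * E.card ≤ (S v).card) :
    ∃ F : Finset α, (F.card : ℝ) ≤ Real.log (Fintype.card ι) / p + 1 ∧
      ∀ v, ∃ e ∈ F, e ∈ S v := by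
  set t := ⌊Real.log (Fintype.card ι) / p⌋₊ + 1 with ht
  obtain ⟨F, hF, hU⟩ := exists_greedy_hitting E S hSE hp hE hS t
  have hn : (0 : ℝ) < Fintype.card ι := by exact_mod_cast Fintype.card_pos
  have hlog : 0 ≤ Real.log (Fintype.card ι) / p := div_nonneg (Real.log_natCast_nonneg _) hp0.le
  refine ⟨F, ?_, fun v => ?_⟩
  · calc (F.card : ℝ) ≤ t := by exact_mod_cast hF
      _ ≤ _ := by
        rw [ht]; push_cast
        linarith [Nat.floor_le hlog]
  · by_contra! hv
    have h1 : (1 : ℝ) ≤ ((Finset.univ.filter fun v => Disjoint (S v) F).card : ℝ) := by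
      have : 0 < (Finset.univ.filter fun v => Disjoint (S v) F).card :=
        Finset.card_pos.2 ⟨v, by
          simpa using Finset.disjoint_right.2 hv⟩
      exact_mod_cast this
    have ht' : Real.log (Fintype.card ι) < p * t := by
      have := Nat.lt_floor_add_one (Real.log (Fintype.card ι) / p)
      rw [div_lt_iff₀ hp0] at this
      rw [ht]; push_cast
      linarith
    have h2 : (1 - p) ^ t ≤ Real.exp (-(p * t)) := by
      calc (1 - p) ^ t ≤ Real.exp (-p) ^ t :=
            pow_le_pow_left₀ (by linarith) (by linarith [Real.add_one_le_exp (-p)]) t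
        _ = _ := by rw [← Real.exp_nat_mul]; ring_nf
    have h3 : Real.exp (-(p * t)) < (Fintype.card ι : ℝ)⁻¹ := by
      rw [← Real.exp_log (inv_pos.2 hn), Real.log_inv]
      exact Real.exp_lt_exp.2 (by linarith)
    have h4 : (Fintype.card ι : ℝ) * (1 - p) ^ t < 1 := by
      calc (Fintype.card ι : ℝ) * (1 - p) ^ t < Fintype.card ι * (Fintype.card ι : ℝ)⁻¹ :=
            mul_lt_mul_of_pos_left (h2.trans_lt h3) hn
        _ = 1 := mul_inv_cancel₀ hn.ne'
    linarith

open MeasureTheory in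
/-- The set of shifts `s ∈ [0, r)`, with `r ≤ δ`, for which the progression `a + s - i δ` meets
an interval has measure at most the length of the interval. -/
theorem volume_shifts_le {a b c δ r : ℝ} (hrδ : r ≤ δ) :
    volume {s : ℝ | s ∈ Set.Ico 0 r ∧ ∃ i : ℕ, b < a + s - i * δ ∧ a + s - i * δ ≤ c} ≤
      ENNReal.ofReal (c - b) := by
  set T : ℕ → Set ℝ := fun i => Set.Ico (a - i * δ) (a - i * δ + r) ∩ Set.Ioc b c with hT
  have hsub : {s : ℝ | s ∈ Set.Ico 0 r ∧ ∃ i : ℕ, b < a + s - i * δ ∧ a + s - i * δ ≤ c} ⊆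
      ⋃ i : ℕ, (fun s => s + (a - i * δ)) ⁻¹' T i := by
    rintro s ⟨⟨h0, h1⟩, i, h2, h3⟩
    refine Set.mem_iUnion.2 ⟨i, ⟨?_, ?_⟩, ?_, ?_⟩ <;> dsimp only <;> linarith
  have hdisj : Pairwise (Function.onFun Disjoint T) := by
    intro i j hij
    wlog hlt : i < j generalizing i j
    · exact (this hij.symm (lt_of_le_of_ne (not_lt.1 hlt) hij.symm)).symm
    refine Set.disjoint_left.2 ?_
    rintro x ⟨⟨h1, h2⟩, -⟩ ⟨⟨h3, h4⟩, -⟩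
    have hij' : (i : ℝ) + 1 ≤ j := by exact_mod_cast hlt
    nlinarith
  calc _ ≤ volume (⋃ i : ℕ, (fun s => s + (a - i * δ)) ⁻¹' T i) := measure_mono hsub
    _ ≤ ∑' i : ℕ, volume ((fun s => s + (a - i * δ)) ⁻¹' T i) := measure_iUnion_le _
    _ = ∑' i, volume (T i) := by simp only [measure_preimage_add_right]
    _ = volume (⋃ i, T i) :=
      (measure_iUnion hdisj fun i => measurableSet_Ico.inter measurableSet_Ioc).symm
    _ ≤ volume (Set.Ioc b c) := measure_mono (Set.iUnion_subset fun i => Set.inter_subset_right)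
    _ = _ := Real.volume_Ioc

open MeasureTheory in
open scoped Classical in
/-- If each of the sets `A e` has measure at most `W`, then some point of `[0, r)` lies in at most
the average number of them. -/
theorem exists_card_filter_mem_le {α : Type*} (E : Finset α) (A : α → Set ℝ)
    (hA : ∀ e, MeasurableSet (A e)) {W r : ℝ} (hW : 0 ≤ W) (hr : 0 < r)
    (hvol : ∀ e ∈ E, volume (A e) ≤ ENNReal.ofReal W) :
    ∃ s ∈ Set.Ico 0 r, ((E.filter fun e => s ∈ A e).card : ℝ) ≤ E.card * W / r := by
  have hvr : volume (Set.Ico 0 r) = ENNReal.ofReal r := by simp [Real.volume_Ico]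
  by_contra! hcon
  set f : ℝ → ENNReal := fun s => ∑ e ∈ E, (A e).indicator 1 s with hf
  have hfeq : ∀ s, f s = ((E.filter fun e => s ∈ A e).card : ENNReal) := by
    intro s
    simp [hf, Set.indicator_apply, Finset.sum_boole]
  have hfm : Measurable f :=
    Finset.measurable_fun_sum _ fun e _ => measurable_one.indicator (hA e)
  have h1 : ∫⁻ s in Set.Ico 0 r, f s ≤ E.card * ENNReal.ofReal W := by
    calc ∫⁻ s in Set.Ico 0 r, f s ≤ ∫⁻ s, f s := setLIntegral_le_lintegral _ _
      _ = ∑ e ∈ E, ∫⁻ s, (A e).indicator 1 s :=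
        lintegral_finsetSum _ fun e _ => measurable_one.indicator (hA e)
      _ = ∑ e ∈ E, volume (A e) := by simp only [lintegral_indicator_one (hA _)]
      _ ≤ ∑ _e ∈ E, ENNReal.ofReal W := Finset.sum_le_sum hvol
      _ = _ := by simp
  have hpos : volume (Set.Ico 0 r) ≠ 0 := by simp [hvr, hr]
  have hfin : ∫⁻ s in Set.Ico 0 r, f s ≠ ⊤ :=
    ne_top_of_le_ne_top (ENNReal.mul_ne_top (by simp) (by simp)) h1
  obtain ⟨s, hs, hle⟩ := exists_le_setLAverage hpos (by simp [hvr]) hfm.aemeasurable.restrict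
  rw [setLAverage_eq, hvr, hfeq] at hle
  have h2 : ((E.filter fun e => s ∈ A e).card : ENNReal) ≤ ENNReal.ofReal (E.card * W / r) := by
    refine hle.trans ?_
    rw [ENNReal.ofReal_div_of_pos hr, ENNReal.ofReal_mul (by positivity), ENNReal.ofReal_natCast]
    exact ENNReal.div_le_div_right h1 _
  rw [← ENNReal.ofReal_natCast, ENNReal.ofReal_le_ofReal_iff (by positivity)] at h2
  exact absurd h2 (not_le.2 (hcon s hs))

theorem exists_edge_of_ne {G : DWGraph V} (hconn : StronglyConnected G) {u v : V} (h : u ≠ v) :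
    ∃ y, G.Edge u y := by
  obtain ⟨l, hl⟩ := hconn u v
  exact IsWalk.rec_cons (P := fun u _ => u ≠ v → ∃ y, G.Edge u y) (fun h => absurd rfl h)
    (fun x y _ hxy _ _ _ => ⟨y, hxy⟩) l u hl h

theorem card_le_card_edges [Fintype V] {G : DWGraph V} (hconn : StronglyConnected G)
    (hn : 2 ≤ Fintype.card V) : Fintype.card V ≤ {p : V × V | G.Edge p.1 p.2}.ncard := by
  have : Nontrivial V := Fintype.one_lt_card_iff_nontrivial.1 hn
  choose y hy using fun u : V =>
    exists_edge_of_ne hconn (exists_ne u).choose_spec.symm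
  rw [← Nat.card_eq_fintype_card, ← Set.ncard_univ]
  refine Set.ncard_le_ncard_of_injOn (fun u => (u, y u)) (fun u _ => hy u) ?_ (Set.toFinite _)
  intro a _ b _ h
  exact congrArg Prod.fst h

/-- Let `k ≥ 2`, `1 ≤ ℓ ≤ k−1`, and let `G` be a finite strongly connected
directed weighted graph with `n ≥ 2` vertices, `m` edges, all edge weights in `[1, Wmax]`,
all distances at most `D > 0`, and `r > 0`.  Then either there is `X` with
`|X| ≤ 8·m^{1−ℓ/k}·Wmax·log m` and `d(X,v) ≤ (ℓ/k)·D + r` for all `v`, or there is `X'`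
with `|X'| ≤ 8·m^{ℓ/k}·(log m)/r` and `d(v,X') ≤ ((k−ℓ)/k)·D` for all `v`. -/
theorem stmt7 [Fintype V] (G : DWGraph V) (k ℓ : ℕ)
    (hk : 2 ≤ k) (hl1 : 1 ≤ ℓ) (hlk : ℓ ≤ k - 1)
    (n m : ℕ) (hn : Fintype.card V = n) (hn2 : 2 ≤ n)
    (hm : {p : V × V | G.Edge p.1 p.2}.ncard = m)
    (hconn : StronglyConnected G)
    (Wmax : ℝ) (hw : ∀ u v : V, G.Edge u v → 1 ≤ G.w u v ∧ G.w u v ≤ Wmax)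
    (D r : ℝ) (hD : 0 < D) (hr : 0 < r)
    (hdiam : ∀ u v : V, gdist G u v ≤ D) :
    (∃ X : Finset V,
        (X.card : ℝ) ≤ 8 * (m : ℝ) ^ ((1 : ℝ) - (ℓ : ℝ) / (k : ℝ)) * Wmax * Real.log m ∧
        ∀ v : V, ∃ x ∈ X, gdist G x v ≤ ((ℓ : ℝ) / (k : ℝ)) * D + r) ∨
    (∃ X' : Finset V,
        (X'.card : ℝ) ≤ 8 * (m : ℝ) ^ ((ℓ : ℝ) / (k : ℝ)) * Real.log m / r ∧
        ∀ v : V, ∃ x ∈ X', gdist G v x ≤ (((k : ℝ) - (ℓ : ℝ)) / (k : ℝ)) * D) := by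
  classical
  have hmn : n ≤ m := by rw [← hn, ← hm]; exact card_le_card_edges hconn (hn ▸ hn2)
  have hne : Nonempty V := Fintype.card_pos_iff.1 (by lia)
  set α : ℝ := (ℓ : ℝ) / k with hα
  have hk0 : (0 : ℝ) < k := by exact_mod_cast (by lia : 0 < k)
  have hα0 : 0 < α := div_pos (by exact_mod_cast hl1) hk0
  have hα1 : α < 1 := (div_lt_one hk0).2 (by exact_mod_cast (by lia : ℓ < k))
  have hβ : ((k : ℝ) - ℓ) / k = 1 - α := by rw [hα]; field_simp
  rw [hβ]
  have hm2 : (2 : ℝ) ≤ m := by exact_mod_cast hn2.trans hmn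
  have hm0 : (0 : ℝ) < m := by linarith
  have hlog : 1 / 2 ≤ Real.log m := by
    have := Real.log_le_log two_pos hm2
    linarith [Real.log_two_gt_d9]
  set E : Finset (V × V) := Finset.univ.filter fun p => G.Edge p.1 p.2 with hEdef
  have hEm : E.card = m := by
    rw [← hm, ← Set.ncard_coe_finset]
    congr 1
    ext p
    simp [hEdef]
  have hEne : E.Nonempty := Finset.card_pos.1 (by rw [hEm]; lia)
  have hW : 1 ≤ Wmax := by
    obtain ⟨p, hp⟩ := hEne
    have := hw p.1 p.2 (by simpa [hEdef] using hp)
    linarith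
  have hW0 : 0 < Wmax := by linarith
  have hpow1 : 1 ≤ (m : ℝ) ^ (1 - α) := Real.one_le_rpow (by linarith) (by linarith)
  have hpowα : 0 < (m : ℝ) ^ α := Real.rpow_pos_of_pos hm0 _
  have hpowmul : (m : ℝ) ^ α * (m : ℝ) ^ (1 - α) = m := by
    rw [← Real.rpow_add hm0]; simp
  have hKW : 1 ≤ (m : ℝ) ^ (1 - α) * Wmax := one_le_mul_of_one_le_of_one_le hpow1 hW
  have hKL : 1 / 2 ≤ (m : ℝ) ^ (1 - α) * Wmax * Real.log m := by nlinarith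
  rcases lt_or_ge ((1 - α) * D) r with hrbig | hrδ
  · left
    obtain ⟨x⟩ := hne
    refine ⟨{x}, ?_, fun v => ⟨x, by simp, (hdiam x v).trans (by linarith)⟩⟩
    rw [Finset.card_singleton]; push_cast
    linarith
  set S : V → Finset (V × V) := fun v => E.filter fun p => gdist G p.2 v < α * D + r with hS
  by_cases hbig : ∀ v, (m : ℝ) ^ α / Wmax ≤ (S v).card
  · left
    obtain ⟨F, hF, hhit⟩ := exists_hitting_set E S (fun v => Finset.filter_subset _ _)
      (p := ((m : ℝ) ^ (1 - α) * Wmax)⁻¹) (by positivity) (inv_le_one_of_one_le₀ hKW) hEne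
      (fun v => by
        refine le_trans (le_of_eq ?_) (hbig v)
        rw [hEm]
        nth_rewrite 2 [← hpowmul]
        field_simp)
    refine ⟨F.image Prod.snd, ?_, fun v => ?_⟩
    · rw [div_inv_eq_mul, hn] at hF
      have h1 : ((F.image Prod.snd).card : ℝ) ≤ F.card := by exact_mod_cast Finset.card_image_le
      have h2 : Real.log n ≤ Real.log m :=
        Real.log_le_log (by exact_mod_cast (by lia : 0 < n)) (by exact_mod_cast hmn)
      have h3 := mul_le_mul_of_nonneg_right h2 (zero_le_one.trans hKW)
      linarith
    · obtain ⟨e, heF, heS⟩ := hhit v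
      exact ⟨e.2, Finset.mem_image_of_mem _ heF, (Finset.mem_filter.1 heS).2.le⟩
  · right
    push Not at hbig
    obtain ⟨v, hv⟩ := hbig
    set δ : ℝ := (1 - α) * D with hδ
    have hδ0 : 0 < δ := by linarith
    set A : V × V → Set ℝ := fun e => {s : ℝ | s ∈ Set.Ico 0 r ∧
      ∃ i : ℕ, gdist G e.2 v < α * D + s - i * δ ∧ α * D + s - i * δ ≤ gdist G e.1 v} with hA
    have hAm : ∀ e, MeasurableSet (A e) := fun e =>
      measurableSet_Ico.inter <| measurableSet_setOfPred.2 <| Measurable.exists fun i =>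
        (measurableSet_setOfPred.1 (measurableSet_lt (by fun_prop) (by fun_prop))).and
          (measurableSet_setOfPred.1 (measurableSet_le (by fun_prop) (by fun_prop)))
    obtain ⟨s, hs, hcount⟩ := exists_card_filter_mem_le (S v) A hAm hW0.le hr (fun e he => by
      refine (volume_shifts_le hrδ).trans (ENNReal.ofReal_le_ofReal ?_)
      have hed : G.Edge e.1 e.2 := by
        simpa [hEdef] using (Finset.mem_filter.1 he).1
      linarith [gdist_le_add hconn hed v, (hw _ _ hed).2])
    set C := (S v).filter fun e => s ∈ A e with hC
    replace hcount : (C.card : ℝ) ≤ (S v).card * Wmax / r := by convert hcount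
    have hmem : ∀ x y : V, ∀ i : ℕ, G.Edge x y → gdist G y v < α * D + s - i * δ →
        α * D + s - i * δ ≤ gdist G x v → (x, y) ∈ C := by
      intro x y i hxy h1 h2
      have : 0 ≤ i * δ := by positivity
      simp only [hC, hS, hEdef, hA, Finset.mem_filter, Finset.mem_univ, true_and, Set.mem_ofPred_eq]
      exact ⟨⟨hxy, by linarith [hs.2]⟩, hs, i, h1, h2⟩
    have hαD : 0 < α * D := mul_pos hα0 hD
    have hCpos : 1 ≤ (C.card : ℝ) := by
      obtain ⟨u, hu⟩ : ∃ u, α * D + r ≤ gdist G u v := by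
        by_contra! hcon
        have hSE : S v = E := Finset.filter_true_of_mem fun p _ => hcon p.2
        rw [hSE, hEm, lt_div_iff₀ hW0] at hv
        have : (m : ℝ) ^ α ≤ m := by nlinarith
        nlinarith
      obtain ⟨x, y, h1, h2, h3, -⟩ := exists_crossing hconn (u := u) (v := v)
        (ρ := α * D + s) (by linarith [hs.1]) (by linarith [hs.2])
      have : 0 < C.card := 
        Finset.card_pos.2 ⟨_, hmem x y 0 h1 (by simpa using h2) (by simpa using h3)⟩
      exact_mod_cast this
    refine ⟨insert v (C.image Prod.fst), ?_, fun u => ?_⟩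
    · have h1 : ((insert v (C.image Prod.fst)).card : ℝ) ≤ C.card + 1 := by
        exact_mod_cast (Finset.card_insert_le _ _).trans (by
          gcongr; exact Finset.card_image_le)
      have h2 : ((S v).card : ℝ) * Wmax ≤ (m : ℝ) ^ α := ((lt_div_iff₀ hW0).1 hv).le
      have h3 : ((S v).card : ℝ) * Wmax / r ≤ (m : ℝ) ^ α / r := by gcongr
      have h4 : 2 * ((m : ℝ) ^ α / r) ≤ 8 * (m : ℝ) ^ α * Real.log m / r := by
        rw [← mul_div_assoc]
        refine div_le_div_of_nonneg_right ?_ hr.le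
        nlinarith
      linarith
    · have hex : ∃ i : ℕ, α * D + s - i * δ ≤ gdist G u v := by
        obtain ⟨i, hi⟩ := exists_nat_ge ((α * D + s) / δ)
        rw [div_le_iff₀ hδ0] at hi
        exact ⟨i, by linarith [gdist_nonneg G u v]⟩
      obtain ⟨hi, hmin⟩ := And.intro (Nat.find_spec hex) fun j hj => Nat.find_min hex (m := j) hj
      set i := Nat.find hex
      have hgap : gdist G u v - (α * D + s - i * δ) ≤ δ := by
        rcases Nat.eq_zero_or_pos i with h0 | h0
        · rw [h0]; push_cast
          have := hdiam u v
          linarith [hs.1]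
        · have h1 := hmin (i - 1) (by lia)
          rw [Nat.cast_sub h0] at h1
          push_cast at h1
          linarith
      rcases lt_or_ge 0 (α * D + s - i * δ) with hρ | hρ
      · obtain ⟨x, y, h1, h2, h3, h4⟩ := exists_crossing hconn hρ hi
        exact ⟨x, Finset.mem_insert_of_mem (Finset.mem_image.2 ⟨_, hmem x y i h1 h2 h3, rfl⟩),
          h4.trans hgap⟩
      · exact ⟨v, Finset.mem_insert_self _ _, by linarith⟩

end Stmt7
end

section
/- Let k ≥ 2 and ℓ with 1 ≤ ℓ ≤ k be integers, and let D ≥ 0 and r ≥ 0 be real numbers. Suppose X, X′ ⊆ V are such that: for every v ∈ V there exists x ∈ X with d(v,x) ≤ ((k−ℓ)/k)·D; for every v ∈ V there exists x′ ∈ X′ with d(x′,v) ≤ ((ℓ−1)/k)·D + r; and d(x,x′) ≤ D for all x ∈ X and x′ ∈ X′. Then d(v,v′) ≤ (2 − 1/k)·D + r for all v, v′ ∈ V. In particular, if D > 0, ε > 0 and r = (ε/2)·D, then d(v,v′) < (2 − 1/k + ε)·D for all v, v′ ∈ V. -/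
/-- Let `d : V × V → ℝ` satisfy the triangle inequality, `k ≥ 2`,
`1 ≤ ℓ ≤ k`, `D ≥ 0`, `r ≥ 0`.  If every `v` is within `((k−ℓ)/k)·D` of `X`,
every `v` is within `((ℓ−1)/k)·D + r` from `X′`, and `d(x,x′) ≤ D` for all
`x ∈ X, x′ ∈ X′`, then `d(v,v′) ≤ (2 − 1/k)·D + r` for all `v, v′`; in
particular, if `D > 0`, `ε > 0` and `r = (ε/2)·D`, then
`d(v,v′) < (2 − 1/k + ε)·D` for all `v, v′`. -/
theorem stmt8 {V : Type*} (d : V → V → ℝ)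
    (htri : ∀ u v w : V, d u w ≤ d u v + d v w)
    (k ℓ : ℕ) (hk : 2 ≤ k) (hl1 : 1 ≤ ℓ) (hlk : ℓ ≤ k)
    (D r : ℝ) (hD : 0 ≤ D) (hr : 0 ≤ r)
    (X X' : Set V)
    (hX : ∀ v : V, ∃ x ∈ X, d v x ≤ (((k : ℝ) - (ℓ : ℝ)) / (k : ℝ)) * D)
    (hX' : ∀ v : V, ∃ x' ∈ X', d x' v ≤ (((ℓ : ℝ) - 1) / (k : ℝ)) * D + r)
    (hXX' : ∀ x ∈ X, ∀ x' ∈ X', d x x' ≤ D) :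
    (∀ v v' : V, d v v' ≤ (2 - 1 / (k : ℝ)) * D + r) ∧
    (∀ ε : ℝ, 0 < D → 0 < ε → r = (ε / 2) * D →
      ∀ v v' : V, d v v' < (2 - 1 / (k : ℝ) + ε) * D) := by
  have hbound : ∀ v v' : V, d v v' ≤ (2 - 1 / (k : ℝ)) * D + r := by
    intro v v'
    obtain ⟨x, hx, hvx⟩ := hX v
    obtain ⟨x', hx', hxv'⟩ := hX' v'
    have hk0 : (k : ℝ) ≠ 0 := by
      have : k ≠ 0 := by omega
      exact_mod_cast this
    have hsum : (((k : ℝ) - (ℓ : ℝ)) / (k : ℝ)) * D + D + ((((ℓ : ℝ) - 1) / (k : ℝ)) * D + r)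
        = (2 - 1 / (k : ℝ)) * D + r := by
      field_simp
      ring
    linarith [htri v x v', htri x x' v', hXX' x hx x' hx']
  refine ⟨hbound, fun ε hDpos hε hrε v v' => ?_⟩
  have hεD : 0 < ε * D := mul_pos hε hDpos
  linarith [hbound v v', add_mul (2 - 1 / (k : ℝ)) ε D]
end

section
/- Suppose that for all vectors a, b, c ∈ A (not necessarily distinct) there exists a coordinate i ∈ {1,…,d} with a[i] = b[i] = c[i] = 1. Then for every two vertices u, v of the 3-OV Diameter graph H(A,d) there is a walk of length at most 3 from u to v; in particular, H(A,d) is connected and has diameter at most 3. -/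
namespace ThreeOV

/-- Boolean vectors of dimension `d`; `a i = true` encodes `a[i] = 1`. -/
abbrev Vec (d : ℕ) := Fin d → Bool

/-- The vertex type of the 3-OV Diameter graph `H(A,d)`: `Sum.inl (a,b)` is the
`S`-vertex `(a,b)` and `Sum.inr (a,i,j)` is the `X`-vertex `(a,i,j)`. -/
abbrev V3 (d : ℕ) := (Vec d × Vec d) ⊕ (Vec d × Fin d × Fin d)

/-- The vertex set of `H(A,d)`:  `S = A × A` and
`X = {(a,i,j) : a ∈ A, a[i] = a[j] = 1}`. -/
def IsV3 (d : ℕ) (A : Finset (Vec d)) : V3 d → Prop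
  | Sum.inl (a, b) => a ∈ A ∧ b ∈ A
  | Sum.inr (a, i, j) => a ∈ A ∧ a i = true ∧ a j = true

/-- The structural adjacency conditions (i)–(iii) of `H(A,d)` (in one direction). -/
def AdjCore (d : ℕ) : V3 d → V3 d → Prop := fun u v =>
  -- (i) between (a,b) ∈ S and (a,i,j) ∈ X whenever b[i] = 1 or b[j] = 1
  (∃ (a b : Vec d) (i j : Fin d),
      u = Sum.inl (a, b) ∧ v = Sum.inr (a, i, j) ∧ (b i = true ∨ b j = true)) ∨
  -- (ii) between (a,i,j) ∈ X and (b,i,j) ∈ X whenever a ≠ b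
  (∃ (a b : Vec d) (i j : Fin d),
      u = Sum.inr (a, i, j) ∧ v = Sum.inr (b, i, j) ∧ a ≠ b) ∨
  -- (iii) between (a,i,j) ∈ X and (a,i′,j′) ∈ X whenever (i,j) ≠ (i′,j′)
  (∃ (a : Vec d) (i j i' j' : Fin d),
      u = Sum.inr (a, i, j) ∧ v = Sum.inr (a, i', j') ∧ (i, j) ≠ (i', j'))

/-- Adjacency in the (undirected) graph `H(A,d)`: both endpoints are vertices and one of
the adjacency conditions holds (in either direction). -/
def Adj (d : ℕ) (A : Finset (Vec d)) (u v : V3 d) : Prop :=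
  IsV3 d A u ∧ IsV3 d A v ∧ (AdjCore d u v ∨ AdjCore d v u)

/-- There is a walk of length `ℓ` from `u` to `v` in `H(A,d)`. -/
def HasWalk (d : ℕ) (A : Finset (Vec d)) (u v : V3 d) (ℓ : ℕ) : Prop :=
  ∃ w : ℕ → V3 d, w 0 = u ∧ w ℓ = v ∧ ∀ t, t < ℓ → Adj d A (w t) (w (t + 1))

theorem Adj.symm {d : ℕ} {A : Finset (Vec d)} {u v : V3 d} (h : Adj d A u v) :
    Adj d A v u :=
  ⟨h.2.1, h.1, h.2.2.symm⟩

theorem HasWalk.refl {d : ℕ} {A : Finset (Vec d)} (u : V3 d) : HasWalk d A u u 0 :=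
  ⟨fun _ => u, rfl, rfl, fun _ ht => absurd ht (Nat.not_lt_zero _)⟩

theorem HasWalk.cons {d : ℕ} {A : Finset (Vec d)} {u v w : V3 d} {n : ℕ}
    (h : Adj d A u v) (hw : HasWalk d A v w n) : HasWalk d A u w (n + 1) := by
  obtain ⟨p, rfl, rfl, hp⟩ := hw
  refine ⟨fun t => Nat.casesOn t u p, rfl, rfl, fun t ht => ?_⟩
  cases t with
  | zero => exact h
  | succ t => exact hp t (Nat.lt_of_succ_lt_succ ht)

theorem exists_hasWalk_cons {d : ℕ} {A : Finset (Vec d)} {u v w : V3 d} {n : ℕ}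
    (h : u = v ∨ Adj d A u v) (hw : ∃ ℓ ≤ n, HasWalk d A v w ℓ) :
    ∃ ℓ ≤ n + 1, HasWalk d A u w ℓ := by
  obtain ⟨ℓ, hℓ, hw⟩ := hw
  rcases h with rfl | h
  · exact ⟨ℓ, by omega, hw⟩
  · exact ⟨ℓ + 1, by omega, hw.cons h⟩

theorem exists_hasWalk_le_three {d : ℕ} {A : Finset (Vec d)} {u x y v : V3 d}
    (hux : u = x ∨ Adj d A u x) (hxy : x = y ∨ Adj d A x y) (hyv : y = v ∨ Adj d A y v) :
    ∃ ℓ ≤ 3, HasWalk d A u v ℓ :=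
  exists_hasWalk_cons hux <| exists_hasWalk_cons hxy <| exists_hasWalk_cons hyv
    ⟨0, le_rfl, HasWalk.refl v⟩

theorem adj_inl_inr {d : ℕ} {A : Finset (Vec d)} {a b : Vec d} {i j : Fin d}
    (ha : a ∈ A) (hb : b ∈ A) (hi : a i = true) (hj : a j = true)
    (hij : b i = true ∨ b j = true) : Adj d A (Sum.inl (a, b)) (Sum.inr (a, i, j)) :=
  ⟨⟨ha, hb⟩, ⟨ha, hi, hj⟩, Or.inl (Or.inl ⟨a, b, i, j, rfl, rfl, hij⟩)⟩

theorem eq_or_adj_of_same_coords {d : ℕ} {A : Finset (Vec d)} {a b : Vec d} {i j : Fin d}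
    (ha : IsV3 d A (Sum.inr (a, i, j))) (hb : IsV3 d A (Sum.inr (b, i, j))) :
    (Sum.inr (a, i, j) : V3 d) = Sum.inr (b, i, j) ∨
      Adj d A (Sum.inr (a, i, j)) (Sum.inr (b, i, j)) := by
  by_cases hab : a = b
  · exact Or.inl (by rw [hab])
  · exact Or.inr ⟨ha, hb, Or.inl (Or.inr (Or.inl ⟨a, b, i, j, rfl, rfl, hab⟩))⟩

theorem eq_or_adj_of_same_vec {d : ℕ} {A : Finset (Vec d)} {a : Vec d} {p q : Fin d × Fin d}
    (hp : IsV3 d A (Sum.inr (a, p))) (hq : IsV3 d A (Sum.inr (a, q))) :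
    (Sum.inr (a, p) : V3 d) = Sum.inr (a, q) ∨ Adj d A (Sum.inr (a, p)) (Sum.inr (a, q)) := by
  by_cases hpq : p = q
  · exact Or.inl (by rw [hpq])
  · exact Or.inr ⟨hp, hq,
      Or.inl (Or.inr (Or.inr ⟨a, p.1, p.2, q.1, q.2, rfl, rfl, hpq⟩))⟩

end ThreeOV

open ThreeOV in
/-- If every three vectors `a, b, c ∈ A` (not necessarily distinct) have a
common coordinate `i` with `a[i] = b[i] = c[i] = 1`, then any two vertices of `H(A,d)`
are joined by a walk of length at most 3 (so `H(A,d)` is connected with diameter ≤ 3). -/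
theorem stmt10 (d : ℕ) (hd : 1 ≤ d) (A : Finset (Vec d))
    (h : ∀ a ∈ A, ∀ b ∈ A, ∀ c ∈ A,
      ∃ i : Fin d, a i = true ∧ b i = true ∧ c i = true) :
    ∀ u v : V3 d, IsV3 d A u → IsV3 d A v → ∃ ℓ ≤ 3, HasWalk d A u v ℓ := by
  rintro (⟨a, b⟩ | ⟨a, i, j⟩) (⟨a', b'⟩ | ⟨a', i', j'⟩) hu hv
  · obtain ⟨i, hia, hia', hib⟩ := h a hu.1 a' hv.1 b hu.2
    obtain ⟨j, hja, hja', hjb'⟩ := h a hu.1 a' hv.1 b' hv.2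
    exact exists_hasWalk_le_three
      (Or.inr (adj_inl_inr hu.1 hu.2 hia hja (Or.inl hib)))
      (eq_or_adj_of_same_coords ⟨hu.1, hia, hja⟩ ⟨hv.1, hia', hja'⟩)
      (Or.inr (adj_inl_inr hv.1 hv.2 hia' hja' (Or.inr hjb')).symm)
  · obtain ⟨k, hka, hka', hkb⟩ := h a hu.1 a' hv.1 b hu.2
    exact exists_hasWalk_le_three
      (Or.inr (adj_inl_inr hu.1 hu.2 hka hka (Or.inl hkb)))
      (eq_or_adj_of_same_coords ⟨hu.1, hka, hka⟩ ⟨hv.1, hka', hka'⟩)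
      (eq_or_adj_of_same_vec ⟨hv.1, hka', hka'⟩ hv)
  · obtain ⟨k, hka, hka', hkb'⟩ := h a hu.1 a' hv.1 b' hv.2
    exact exists_hasWalk_le_three
      (eq_or_adj_of_same_vec hu ⟨hu.1, hka, hka⟩)
      (eq_or_adj_of_same_coords ⟨hu.1, hka, hka⟩ ⟨hv.1, hka', hka'⟩)
      (Or.inr (adj_inl_inr hv.1 hv.2 hka' hka' (Or.inl hkb')).symm)
  · obtain ⟨k, hka, hka', -⟩ := h a hu.1 a' hv.1 a' hv.1
    exact exists_hasWalk_le_three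
      (eq_or_adj_of_same_vec hu ⟨hu.1, hka, hka⟩)
      (eq_or_adj_of_same_coords ⟨hu.1, hka, hka⟩ ⟨hv.1, hka', hka'⟩)
      (eq_or_adj_of_same_vec ⟨hv.1, hka', hka'⟩ hv)
end

section
/- Suppose a, b, c ∈ A satisfy a ≠ c and a[i]·b[i]·c[i] = 0 for every coordinate i ∈ {1,…,d}. Then in the 3-OV Diameter graph H(A,d) there is no walk of length at most 4 from the vertex (a,b) ∈ S to the vertex (c,b) ∈ S; in particular, these two vertices are at distance at least 5. -/
namespace ThreeOV

theorem Adj.exists_eq_inr {d : ℕ} {A : Finset (Vec d)} {a b : Vec d} {v : V3 d}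
    (h : Adj d A (Sum.inl (a, b)) v) :
    ∃ i j, v = Sum.inr (a, i, j) ∧ a i = true ∧ a j = true ∧ (b i = true ∨ b j = true) := by
  obtain ⟨-, hv, h⟩ := h
  rcases v with ⟨a', b'⟩ | ⟨a', i, j⟩
  · simp [AdjCore] at h
  · simp only [IsV3] at hv
    have : a' = a ∧ (b i = true ∨ b j = true) := by
      simp only [AdjCore] at h
      grind
    obtain ⟨rfl, hb⟩ := this
    exact ⟨i, j, rfl, hv.2.1, hv.2.2, hb⟩

/-- An edge inside `X` preserves the vector or the index pair. -/
theorem Adj.eq_or_eq {d : ℕ} {A : Finset (Vec d)} {a c : Vec d} {i j k l : Fin d}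
    (h : Adj d A (Sum.inr (a, i, j)) (Sum.inr (c, k, l))) : a = c ∨ (i = k ∧ j = l) := by
  obtain ⟨-, -, h⟩ := h
  simp only [AdjCore] at h
  grind

theorem Adj.coords_eq_true {d : ℕ} {A : Finset (Vec d)} {a : Vec d} {i j : Fin d} {v : V3 d}
    (h : Adj d A v (Sum.inr (a, i, j))) : a i = true ∧ a j = true :=
  h.2.1.2

end ThreeOV

open ThreeOV in
/-- If `a, b, c ∈ A` with `a ≠ c` and `a[i]·b[i]·c[i] = 0` for every
coordinate `i`, then in `H(A,d)` there is no walk of length at most 4 from the vertex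
`(a,b) ∈ S` to the vertex `(c,b) ∈ S`. -/
theorem stmt11 (d : ℕ) (hd : 1 ≤ d) (A : Finset (Vec d))
    (a b c : Vec d) (ha : a ∈ A) (hb : b ∈ A) (hc : c ∈ A) (hac : a ≠ c)
    (horth : ∀ i : Fin d, a i = false ∨ b i = false ∨ c i = false) :
    ∀ ℓ ≤ 4, ¬ HasWalk d A (Sum.inl (a, b)) (Sum.inl (c, b)) ℓ := by
  rintro ℓ hℓ ⟨w, h0, hlast, hw⟩
  have first (h : 0 < ℓ) := (h0 ▸ hw 0 h).exists_eq_inr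
  have last (m : ℕ) (h : ℓ = m + 1) :=
    (hlast ▸ h ▸ (hw m (by omega)).symm : Adj d A (Sum.inl (c, b)) (w m)).exists_eq_inr
  rcases Nat.eq_zero_or_pos ℓ with rfl | hpos
  · rw [h0] at hlast
    exact hac (by simpa using hlast)
  obtain ⟨i, j, hx, hai, haj, hbij⟩ := first hpos
  obtain ⟨m, rfl⟩ : ∃ m, ℓ = m + 1 := ⟨ℓ - 1, by omega⟩
  obtain ⟨k, l, hz, hck, hcl, hbkl⟩ := last m rfl
  simp only [zero_add] at hx
  have not_both {p q : Fin d} (hap : a p = true) (haq : a q = true)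
      (hcp : c p = true) (hcq : c q = true) (hbpq : b p = true ∨ b q = true) : False := by
    grind
  obtain rfl | rfl | rfl | rfl : m = 0 ∨ m = 1 ∨ m = 2 ∨ m = 3 := by omega
  · simp [h0] at hz
  · rw [hx] at hz
    exact hac (by simpa using congrArg (Sum.elim Prod.fst Prod.fst) hz)
  · have h12 := hw 1 (by omega)
    rw [hx, hz] at h12
    obtain h | ⟨rfl, rfl⟩ := h12.eq_or_eq
    · exact hac h
    · exact not_both hai haj hck hcl hbij
  · have h12 := hw 1 (by omega)
    have h23 := hw 2 (by omega)
    norm_num only at h12 h23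
    rw [hx] at h12
    rw [hz] at h23
    rcases hy : w 2 with ⟨e, f⟩ | ⟨e, p, q⟩
    · rw [hy] at h12 h23
      obtain ⟨_, _, h1, -⟩ := h12.symm.exists_eq_inr
      obtain ⟨_, _, h2, -⟩ := h23.exists_eq_inr
      simp only [Sum.inr.injEq, Prod.mk.injEq] at h1 h2
      exact hac (h1.1.trans h2.1.symm)
    · rw [hy] at h12 h23
      obtain ⟨hep, heq⟩ := h12.coords_eq_true
      obtain rfl | ⟨rfl, rfl⟩ := h12.eq_or_eq
      · obtain h | ⟨rfl, rfl⟩ := h23.eq_or_eq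
        · exact hac h
        · exact not_both hep heq hck hcl hbkl
      · obtain rfl | ⟨rfl, rfl⟩ := h23.eq_or_eq
        · exact not_both hai haj hep heq hbij
        · exact not_both hai haj hck hcl hbij
end

section
/- Let G be a connected finite simple undirected graph with n ≥ 2 vertices and m ≥ 8 edges such that dist(u,v) ≤ 4 for every pair of vertices u, v. Then either there exists a set Y of vertices with |Y| ≤ m^{1/3} such that every vertex of G is at distance at most 2 from some vertex of Y, or there exists a set X of vertices with |X| ≤ 16·m^{2/3}·log n such that every vertex of G is at distance at most 1 from some vertex of X. -/
/-- Greedy covering: if every set `N x` carries a weight at least `c` out of a total weight `W`,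
then for every `t` some `t` points meet all but a fraction `(1 - c / W) ^ t` of the sets. -/
theorem exists_card_le_card_disjoint_le {V : Type*} [Fintype V] [DecidableEq V]
    (w : V → ℝ) (hw : ∀ a, 0 < w a) (N : V → Finset V) {c W : ℝ} (hW : ∑ a, w a = W)
    (hW0 : 0 < W) (hcW : c ≤ W) (hc : ∀ x, c ≤ ∑ a ∈ N x, w a) (t : ℕ) :
    ∃ X : Finset V, X.card ≤ t ∧
      ((Finset.univ.filter fun x => Disjoint X (N x)).card : ℝ)
        ≤ Fintype.card V * (1 - c / W) ^ t := by
  induction t with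
  | zero => exact ⟨∅, by simp⟩
  | succ t ih =>
    obtain ⟨X, hX, hU⟩ := ih
    set U := Finset.univ.filter fun x => Disjoint X (N x) with hUdef
    have hq : 0 ≤ 1 - c / W := by
      rw [sub_nonneg, div_le_one hW0]; exact hcW
    obtain hV | hV := isEmpty_or_nonempty V
    · exact ⟨∅, by simp, by simp⟩
    have hsum : ∑ a, w a * (c / W * U.card)
        ≤ ∑ a, w a * ((U.filter fun x => a ∈ N x).card : ℝ) := by
      have h1 : ∑ a, w a * ((U.filter fun x => a ∈ N x).card : ℝ)
          = ∑ x ∈ U, ∑ a ∈ N x, w a := by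
        have h2 : ∀ a, w a * ((U.filter fun x => a ∈ N x).card : ℝ)
            = ∑ x ∈ U, if a ∈ N x then w a else 0 := by
          intro a
          rw [← Finset.sum_filter, Finset.sum_const, nsmul_eq_mul, mul_comm]
        simp_rw [h2]
        rw [Finset.sum_comm]
        simp
      rw [h1, ← Finset.sum_mul, hW]
      calc W * (c / W * U.card) = ∑ x ∈ U, c := by
            rw [Finset.sum_const, nsmul_eq_mul]; field_simp
        _ ≤ _ := Finset.sum_le_sum fun x _ => hc x
    obtain ⟨a, -, ha⟩ := Finset.exists_le_of_sum_le Finset.univ_nonempty hsum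
    have ha' := le_of_mul_le_mul_left ha (hw a)
    refine ⟨insert a X, (Finset.card_insert_le a X).trans (by omega), ?_⟩
    have hsub : (Finset.univ.filter fun x => Disjoint (insert a X) (N x))
        = U.filter fun x => a ∉ N x := by
      ext x
      simp [hUdef, Finset.disjoint_insert_left, and_comm]
    have hcard := Finset.card_filter_add_card_filter_not (s := U) (fun x => a ∈ N x)
    have hcard' : ((U.filter fun x => a ∈ N x).card : ℝ)
        + (U.filter fun x => a ∉ N x).card = U.card := by exact_mod_cast hcard
    rw [hsub]
    calc ((U.filter fun x => a ∉ N x).card : ℝ) ≤ U.card * (1 - c / W) := by linarith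
      _ ≤ (Fintype.card V * (1 - c / W) ^ t) * (1 - c / W) := by gcongr
      _ = _ := by ring

/-- If every set `N x` carries a weight at least `c` out of a total weight `W`, then some set of at
most `(W / c) * log n + 1` points meets all `n` sets. -/
theorem exists_hitting_set_card_le {V : Type*} [Fintype V] [DecidableEq V] [Nonempty V]
    (w : V → ℝ) (hw : ∀ a, 0 < w a) (N : V → Finset V) {c W : ℝ} (hW : ∑ a, w a = W)
    (hc0 : 0 < c) (hc : ∀ x, c ≤ ∑ a ∈ N x, w a) :
    ∃ X : Finset V, (X.card : ℝ) ≤ W / c * Real.log (Fintype.card V) + 1 ∧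
      ∀ x, ∃ a ∈ X, a ∈ N x := by
  have hcW : c ≤ W := by
    obtain ⟨x⟩ := ‹Nonempty V›
    rw [← hW]
    exact (hc x).trans (Finset.sum_le_sum_of_subset_of_nonneg (Finset.subset_univ _)
      fun a _ _ => (hw a).le)
  have hW0 : 0 < W := hc0.trans_le hcW
  have hn : (0 : ℝ) < Fintype.card V := by exact_mod_cast Fintype.card_pos
  have hlog : 0 ≤ Real.log (Fintype.card V) := Real.log_natCast_nonneg _
  set t := ⌊W / c * Real.log (Fintype.card V)⌋₊ + 1 with ht
  obtain ⟨X, hX, hU⟩ := exists_card_le_card_disjoint_le w hw N hW hW0 hcW hc t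
  refine ⟨X, ?_, ?_⟩
  · calc (X.card : ℝ) ≤ t := by exact_mod_cast hX
      _ ≤ _ := by
        rw [ht]; push_cast
        gcongr
        exact Nat.floor_le (by positivity)
  · have hlt : W / c * Real.log (Fintype.card V) < t := by
      rw [ht]; push_cast; exact Nat.lt_floor_add_one _
    have hlt' : Real.log (Fintype.card V) < t * (c / W) := by
      calc Real.log (Fintype.card V) = W / c * Real.log (Fintype.card V) * (c / W) := by field_simp
        _ < _ := by gcongr
    have hone : (Fintype.card V : ℝ) * (1 - c / W) ^ t < 1 := by
      have hq : 0 ≤ 1 - c / W := by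
        rw [sub_nonneg, div_le_one hW0]; exact hcW
      calc (Fintype.card V : ℝ) * (1 - c / W) ^ t
          ≤ Fintype.card V * Real.exp (-(c / W)) ^ t := by
            gcongr
            linarith [Real.add_one_le_exp (-(c / W))]
        _ = Real.exp (Real.log (Fintype.card V) - t * (c / W)) := by
            rw [← Real.exp_nat_mul, sub_eq_add_neg, Real.exp_add, Real.exp_log hn, mul_neg]
        _ < 1 := by rw [Real.exp_lt_one_iff]; linarith
    have hzero := hU.trans_lt hone
    have hempty : (Finset.univ.filter fun x => Disjoint X (N x)) = ∅ := by
      rw [← Finset.card_eq_zero]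
      have : (Finset.univ.filter fun x => Disjoint X (N x)).card < 1 := by exact_mod_cast hzero
      omega
    intro x
    have hx : x ∉ Finset.univ.filter fun x => Disjoint X (N x) := by simp [hempty]
    simpa [Finset.not_disjoint_iff] using hx

theorem SimpleGraph.Connected.exists_dist_le_of_dist_le_add {V : Type*} {G : SimpleGraph V}
    (hG : G.Connected) {u v : V} {i j : ℕ} (h : G.dist u v ≤ i + j) :
    ∃ w, G.dist u w ≤ i ∧ G.dist w v ≤ j := by
  obtain ⟨p, hp⟩ := hG.exists_walk_length_eq_dist u v
  refine ⟨p.getVert i, (SimpleGraph.dist_le (p.take i)).trans ?_,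
    (SimpleGraph.dist_le (p.drop i)).trans ?_⟩
  · simp
  · simp [SimpleGraph.Walk.drop_length]; omega

/-- The ball of radius two around `x` is no larger than the sum of the degrees over the closed
neighbourhood of `x`. -/
theorem SimpleGraph.Connected.card_dist_le_two_le_sum_degree {V : Type*} [Fintype V]
    [DecidableEq V] [Nontrivial V] {G : SimpleGraph V} [DecidableRel G.Adj] (hG : G.Connected)
    (x : V) :
    (Finset.univ.filter fun y => G.dist x y ≤ 2).card
      ≤ ∑ a ∈ Finset.univ.filter (fun a => G.dist x a ≤ 1), G.degree a := by
  refine le_trans (Finset.card_le_card ?_) Finset.card_biUnion_le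
  intro y hy
  simp only [Finset.mem_filter, Finset.mem_univ, true_and, Finset.mem_biUnion,
    SimpleGraph.mem_neighborFinset] at hy ⊢
  obtain ⟨a, hxa, hay⟩ := hG.exists_dist_le_of_dist_le_add (i := 1) (j := 1) hy
  by_cases hady : a = y
  · subst hady
    by_cases hax : x = a
    · subst hax
      obtain ⟨b, hb⟩ := hG.preconnected.exists_adj_of_nontrivial x
      exact ⟨b, (SimpleGraph.dist_eq_one_iff_adj.mpr hb).le, hb.symm⟩
    · refine ⟨x, by simp, SimpleGraph.dist_eq_one_iff_adj.mp ?_⟩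
      have := hG.pos_dist_of_ne hax
      omega
  · refine ⟨a, hxa, SimpleGraph.dist_eq_one_iff_adj.mp ?_⟩
    have := hG.pos_dist_of_ne hady
    omega


/-- Let `G` be a connected finite simple undirected graph with `n ≥ 2`
vertices and `m ≥ 8` edges such that `dist(u,v) ≤ 4` for all `u, v`.  Then either there
is a set `Y` with `|Y| ≤ m^{1/3}` and every vertex at distance at most 2 from `Y`, or
there is a set `X` with `|X| ≤ 16·m^{2/3}·log n` and every vertex at distance at most 1
from `X` (natural logarithm). -/
theorem stmt13 {V : Type*} [Fintype V] (G : SimpleGraph V)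
    (hconn : G.Connected)
    (n m : ℕ) (hn : Fintype.card V = n) (hn2 : 2 ≤ n)
    (hm : G.edgeSet.ncard = m) (hm8 : 8 ≤ m)
    (hdiam : ∀ u v : V, G.dist u v ≤ 4) :
    (∃ Y : Finset V, (Y.card : ℝ) ≤ (m : ℝ) ^ ((1 : ℝ) / 3) ∧
        ∀ v : V, ∃ y ∈ Y, G.dist v y ≤ 2) ∨
    (∃ X : Finset V, (X.card : ℝ) ≤ 16 * (m : ℝ) ^ ((2 : ℝ) / 3) * Real.log n ∧
        ∀ v : V, ∃ x ∈ X, G.dist v x ≤ 1) := by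
  classical
  have hnt : Nontrivial V := Fintype.one_lt_card_iff_nontrivial.mp (by omega)
  have hm0 : (0 : ℝ) < m := by exact_mod_cast (by omega : 0 < m)
  by_cases hball : ∃ x, ((Finset.univ.filter fun y => G.dist x y ≤ 2).card : ℝ)
      ≤ (m : ℝ) ^ ((1 : ℝ) / 3)
  · obtain ⟨x, hx⟩ := hball
    refine Or.inl ⟨_, hx, fun v => ?_⟩
    obtain ⟨y, hxy, hyv⟩ := hconn.exists_dist_le_of_dist_le_add (i := 2) (j := 2) (hdiam x v)
    exact ⟨y, by simpa using hxy, by rwa [SimpleGraph.dist_comm]⟩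
  · push Not at hball
    right
    have hsum : ∑ a, (G.degree a : ℝ) = 2 * m := by
      have h := G.sum_degrees_eq_twice_card_edges
      rw [← SimpleGraph.coe_edgeFinset, Set.ncard_coe_finset] at hm
      rw [hm] at h
      exact_mod_cast h
    obtain ⟨X, hX, hdom⟩ := exists_hitting_set_card_le (fun a => (G.degree a : ℝ))
      (fun a => by exact_mod_cast hconn.preconnected.degree_pos_of_nontrivial a)
      (fun x => Finset.univ.filter fun a => G.dist x a ≤ 1) hsum
      (c := (m : ℝ) ^ ((1 : ℝ) / 3)) (by positivity)
      (fun x => (hball x).le.trans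
        (by exact_mod_cast hconn.card_dist_le_two_le_sum_degree x))
    refine ⟨X, hX.trans ?_, fun v => by simpa using hdom v⟩
    have hdiv : 2 * (m : ℝ) / (m : ℝ) ^ ((1 : ℝ) / 3) = 2 * (m : ℝ) ^ ((2 : ℝ) / 3) := by
      rw [div_eq_iff (by positivity), mul_assoc, ← Real.rpow_add hm0]
      norm_num
    have hlog : 1 / 2 ≤ Real.log n := by
      have h2 : Real.log 2 ≤ Real.log n :=
        Real.log_le_log (by norm_num) (by exact_mod_cast hn2)
      linarith [Real.log_two_gt_d9]
    have hm1 : 1 ≤ (m : ℝ) ^ ((2 : ℝ) / 3) :=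
      Real.one_le_rpow (by exact_mod_cast (by omega : 1 ≤ m)) (by norm_num)
    rw [hdiv, hn]
    nlinarith [mul_le_mul hm1 hlog (by norm_num) (by positivity)]
end
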